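/- arXiv:0706.1788 — 4 statements merged into one kernel-verified Lean document; each statement's English description precedes it below -/
import Mathlib

section
/- For every q₀ > 0, the limit as β → ∞ of the partial derivative with respect to q₀ of the imaginary part of Σ₂(β, q₀, 0, 0) exists and equals −2 I(q₀); that is, lim_{β→∞} Im ∂Σ₂/∂q₀ (β, q₀, 0, 0) = −2 I(q₀). -/
/-- The Fermi function `f_β(E) = 1/(1 + e^{βE})`. -/
noncomputable def fermi (β E : ℝ) : ℝ := 1 / (1 + Real.exp (β * E))

/-- The second-order self-energy of the `xy`-model at inverse temperature `β`,
frequency `q₀` and spatial momentum `(ξ, η)`: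
`Σ₂(β, q₀, ξ, η) = -∫_{[-1,1]⁴} [f_β(E₁)(f_β(E₂) - f_β(E₃)) + f_β(E₂)(f_β(E₃) - 1)]
  / (i q₀ + E₂ - E₃ - E₁)` with `E₁ = (ξ+x-x')(η+y-y')`, `E₂ = xy`, `E₃ = x'y'`. -/
noncomputable def Sigma2 (β q₀ ξ η : ℝ) : ℂ :=
  - ∫ x in (-1 : ℝ)..1, ∫ y in (-1 : ℝ)..1, ∫ x' in (-1 : ℝ)..1, ∫ y' in (-1 : ℝ)..1,
      ((fermi β ((ξ + x - x') * (η + y - y')) * (fermi β (x * y) - fermi β (x' * y'))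
          + fermi β (x * y) * (fermi β (x' * y') - 1) : ℝ) : ℂ) /
        (Complex.I * (q₀ : ℂ) +
          ((x * y - x' * y' - (ξ + x - x') * (η + y - y') : ℝ) : ℂ))

/-- `Φ_{q₀}(ε) = (ε² - q₀²)/(ε² + q₀²)² = Re (1/(i q₀ + ε)²)`. -/
noncomputable def Phi (q₀ ε : ℝ) : ℝ := (ε ^ 2 - q₀ ^ 2) / (ε ^ 2 + q₀ ^ 2) ^ 2

/-- `I(q₀) = 4 ∫₀¹ dy ∫₀¹ dy' ∫₀¹ dx' ∫₀^{x'} dx Φ_{q₀}((2x' - x) y' + y x')`. -/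
noncomputable def Ifun (q₀ : ℝ) : ℝ :=
  4 * ∫ y in (0 : ℝ)..1, ∫ y' in (0 : ℝ)..1, ∫ x' in (0 : ℝ)..1, ∫ x in (0 : ℝ)..x',
    Phi q₀ ((2 * x' - x) * y' + y * x')


open MeasureTheory Set Filter Topology

namespace XY

/-- Lebesgue measure on `[-1,1]`. -/
noncomputable def nu : Measure ℝ := volume.restrict (Icc (-1 : ℝ) 1)

instance : IsFiniteMeasure nu := by unfold nu; infer_instance

instance : NullSingletonClass nu := by unfold nu; infer_instance

/-- Lebesgue measure on `[-1,1]⁴`. -/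
noncomputable def P : Measure (ℝ × ℝ × ℝ × ℝ) := nu.prod (nu.prod (nu.prod nu))

instance : IsFiniteMeasure P := by unfold P; infer_instance

variable {E : Type*} [NormedAddCommGroup E] [NormedSpace ℝ E]

lemma interval_nu (f : ℝ → E) : ∫ x in (-1 : ℝ)..1, f x = ∫ x, f x ∂nu := by
  rw [intervalIntegral.integral_of_le (by norm_num), nu, integral_Icc_eq_integral_Ioc]

lemma interval_ind (f : ℝ → E) (b : ℝ) (h0 : 0 ≤ b) (h1 : b ≤ 1) :
    ∫ x in (0 : ℝ)..b, f x = ∫ x, (Ioc 0 b).indicator f x ∂nu := by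
  rw [intervalIntegral.integral_of_le h0, integral_indicator measurableSet_Ioc, nu,
    Measure.restrict_restrict measurableSet_Ioc, inter_eq_left.2]
  intro x hx
  exact ⟨by linarith [hx.1], hx.2.trans h1⟩

lemma integrable_bdd {α : Type*} [MeasurableSpace α] (μ : Measure α) [IsFiniteMeasure μ]
    (F : α → E) (hF : StronglyMeasurable F) (C : ℝ) (hC : ∀ p, ‖F p‖ ≤ C) : Integrable F μ :=
  Integrable.of_bound hF.aestronglyMeasurable C (Eventually.of_forall hC)

lemma iter (F : ℝ × ℝ × ℝ × ℝ → E) (hF : StronglyMeasurable F) (C : ℝ) (hC : ∀ p, ‖F p‖ ≤ C) :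
    ∫ p, F p ∂P = ∫ a, ∫ b, ∫ c, ∫ d, F (a, b, c, d) ∂nu ∂nu ∂nu ∂nu := by
  unfold P
  rw [integral_prod _ (integrable_bdd _ F hF C hC)]
  congr 1; ext a
  have h1 : StronglyMeasurable (fun q : ℝ × ℝ × ℝ => F (a, q)) :=
    hF.comp_measurable (by fun_prop)
  rw [integral_prod _ (integrable_bdd _ _ h1 C (fun _ => hC _))]
  congr 1; ext b
  have h2 : StronglyMeasurable (fun q : ℝ × ℝ => F (a, b, q)) :=
    hF.comp_measurable (by fun_prop)
  rw [integral_prod _ (integrable_bdd _ _ h2 C (fun _ => hC _))]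

lemma mp_neg : MeasurePreserving (fun x : ℝ => -x) nu nu := by
  have h := (Measure.measurePreserving_neg (volume : Measure ℝ)).restrict_preimage
    (s := Icc (-1 : ℝ) 1) measurableSet_Icc
  have e : (Neg.neg ⁻¹' (Icc (-1 : ℝ) 1)) = Icc (-1 : ℝ) 1 := by
    ext x; simp only [mem_preimage, mem_Icc]
    constructor <;> rintro ⟨h1, h2⟩ <;> constructor <;> linarith
  rw [e] at h
  exact h

lemma mp_id : MeasurePreserving (fun x : ℝ => x) nu nu := MeasurePreserving.id nu

lemma mp_sw {α : Type*} [MeasurableSpace α] (μ : Measure α) [SFinite μ] :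
    MeasurePreserving (fun p : ℝ × ℝ × α => (p.2.1, p.1, p.2.2))
      (nu.prod (nu.prod μ)) (nu.prod (nu.prod μ)) := by
  have h1 := (measurePreserving_prodAssoc nu nu μ).symm
  have h2 := (Measure.measurePreserving_swap (μ := nu) (ν := nu)).prod (MeasurePreserving.id μ)
  have h3 := (measurePreserving_prodAssoc nu nu μ)
  exact h3.comp (h2.comp h1)

/-- swap of coordinates 1,2 -/
lemma s1 : MeasurePreserving (fun p : ℝ × ℝ × ℝ × ℝ => (p.2.1, p.1, p.2.2)) P P := mp_sw _
/-- swap of coordinates 2,3 -/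
lemma s2 : MeasurePreserving (fun p : ℝ × ℝ × ℝ × ℝ => (p.1, p.2.2.1, p.2.1, p.2.2.2)) P P :=
  mp_id.prod (mp_sw nu)
/-- swap of coordinates 3,4 -/
lemma s3 : MeasurePreserving (fun p : ℝ × ℝ × ℝ × ℝ => (p.1, p.2.1, p.2.2.2, p.2.2.1)) P P :=
  mp_id.prod (mp_id.prod (Measure.measurePreserving_swap (μ := nu) (ν := nu)))

lemma t1 : MeasurePreserving (fun p : ℝ × ℝ × ℝ × ℝ => (-p.1, p.2.1, -p.2.2.1, p.2.2.2)) P P :=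
  mp_neg.prod (mp_id.prod (mp_neg.prod mp_id))
lemma t2 : MeasurePreserving (fun p : ℝ × ℝ × ℝ × ℝ => (p.1, -p.2.1, p.2.2.1, -p.2.2.2)) P P :=
  mp_id.prod (mp_neg.prod (mp_id.prod mp_neg))
lemma t3 : MeasurePreserving (fun p : ℝ × ℝ × ℝ × ℝ => (-p.1, -p.2.1, -p.2.2.1, -p.2.2.2)) P P :=
  mp_neg.prod (mp_neg.prod (mp_neg.prod mp_neg))
lemma tS : MeasurePreserving (fun p : ℝ × ℝ × ℝ × ℝ => (p.2.1, p.1, p.2.2.2, p.2.2.1)) P P :=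
  s1.comp s3
/-- `(x,y,x',y') ↦ (-y,y',x',x)` -/
lemma tI : MeasurePreserving (fun p : ℝ × ℝ × ℝ × ℝ => (-p.2.1, p.2.2.2, p.2.2.1, p.1)) P P :=
  (mp_neg.prod (mp_id.prod (mp_id.prod mp_id))).comp (s3.comp (s2.comp (s3.comp s1)))

lemma mp_int {T : ℝ × ℝ × ℝ × ℝ → ℝ × ℝ × ℝ × ℝ} (hT : MeasurePreserving T P P)
    (F : ℝ × ℝ × ℝ × ℝ → ℝ) (hF : StronglyMeasurable F) : ∫ p, F (T p) ∂P = ∫ p, F p ∂P := by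
  have h := integral_map (μ := P) hT.measurable.aemeasurable (f := F)
    (by exact hF.aestronglyMeasurable)
  rw [hT.map_eq] at h
  exact h.symm

lemma phi_bound (q : ℝ) (hq : 0 < q) (e : ℝ) : |Phi q e| ≤ 1 / q ^ 2 := by
  unfold Phi
  have h : 0 < q ^ 2 := by positivity
  have h' : 0 ≤ e ^ 2 := by positivity
  rw [abs_div, abs_of_pos (by positivity : 0 < (e ^ 2 + q ^ 2) ^ 2),
    div_le_div_iff₀ (by positivity) h, one_mul]
  calc |e ^ 2 - q ^ 2| * q ^ 2 ≤ (e ^ 2 + q ^ 2) * (e ^ 2 + q ^ 2) := by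
        apply mul_le_mul _ (by linarith) h.le (by positivity)
        rw [abs_le]; constructor <;> linarith
    _ = _ := by ring

lemma phi_neg (q e : ℝ) : Phi q (-e) = Phi q e := by unfold Phi; ring

lemma phi_meas (q : ℝ) : Measurable (Phi q) := by unfold Phi; fun_prop

/-- The indicator-weighted integrand of `I`, in the variables `(y,y',x',x)`. -/
noncomputable def B (q : ℝ) (p : ℝ × ℝ × ℝ × ℝ) : ℝ :=
  if 0 < p.1 ∧ 0 < p.2.1 ∧ 0 < p.2.2.1 ∧ 0 < p.2.2.2 ∧ p.2.2.2 ≤ p.2.2.1 then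
    Phi q ((2 * p.2.2.1 - p.2.2.2) * p.2.1 + p.1 * p.2.2.1) else 0

lemma B_meas (q : ℝ) : StronglyMeasurable (B q) := by
  apply Measurable.stronglyMeasurable
  unfold B
  refine Measurable.ite ?_ ((phi_meas q).comp (by fun_prop)) measurable_const
  have m1 : Measurable (fun p : ℝ × ℝ × ℝ × ℝ => p.1) := by fun_prop
  have m2 : Measurable (fun p : ℝ × ℝ × ℝ × ℝ => p.2.1) := by fun_prop
  have m3 : Measurable (fun p : ℝ × ℝ × ℝ × ℝ => p.2.2.1) := by fun_prop
  have m4 : Measurable (fun p : ℝ × ℝ × ℝ × ℝ => p.2.2.2) := by fun_prop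
  exact (measurableSet_lt measurable_const m1).inter ((measurableSet_lt measurable_const m2).inter
    ((measurableSet_lt measurable_const m3).inter ((measurableSet_lt measurable_const m4).inter
      (measurableSet_le m4 m3))))

lemma B_bound (q : ℝ) (hq : 0 < q) (p) : ‖B q p‖ ≤ 1 / q ^ 2 := by
  unfold B
  split_ifs
  · exact phi_bound q hq _
  · simp; positivity

lemma nu_ae : ∀ᵐ x ∂nu, x ∈ Icc (-1 : ℝ) 1 := ae_restrict_mem measurableSet_Icc

lemma Ifun_eq (q : ℝ) (hq : 0 < q) : Ifun q = 4 * ∫ p, B q p ∂P := by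
  rw [iter _ (B_meas q) _ (B_bound q hq)]
  unfold Ifun
  congr 1
  rw [interval_ind _ _ zero_le_one le_rfl]
  refine integral_congr_ae (nu_ae.mono fun y hy => ?_)
  by_cases h1 : 0 < y
  swap
  · rw [indicator_of_notMem (fun h => h1 h.1)]
    simp [B, h1]
  rw [indicator_of_mem (show y ∈ Ioc (0 : ℝ) 1 from ⟨h1, hy.2⟩)]
  dsimp only
  rw [interval_ind _ _ zero_le_one le_rfl]
  refine integral_congr_ae (nu_ae.mono fun y' hy' => ?_)
  by_cases h2 : 0 < y'
  swap
  · rw [indicator_of_notMem (fun h => h2 h.1)]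
    simp [B, h2]
  rw [indicator_of_mem (show y' ∈ Ioc (0 : ℝ) 1 from ⟨h2, hy'.2⟩)]
  dsimp only
  rw [interval_ind _ _ zero_le_one le_rfl]
  refine integral_congr_ae (nu_ae.mono fun x' hx' => ?_)
  by_cases h3 : 0 < x'
  swap
  · rw [indicator_of_notMem (fun h => h3 h.1)]
    simp [B, h3]
  rw [indicator_of_mem (show x' ∈ Ioc (0 : ℝ) 1 from ⟨h3, hx'.2⟩)]
  dsimp only
  rw [interval_ind _ _ h3.le hx'.2]
  congr 1; ext x
  by_cases h4 : 0 < x ∧ x ≤ x'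
  · rw [indicator_of_mem (show x ∈ Ioc 0 x' from h4)]
    simp [B, h1, h2, h3, h4.1, h4.2]
  · rw [indicator_of_notMem (show x ∉ Ioc 0 x' from h4)]
    simp only [B, h1, h2, h3, true_and, if_neg h4]

/-- Zero-temperature Fermi function. -/
noncomputable def h (E : ℝ) : ℝ := if E < 0 then 1 else if 0 < E then 0 else 1 / 2

lemma h_n {E : ℝ} (hE : E < 0) : h E = 1 := by simp [h, hE]
lemma h_p {E : ℝ} (hE : 0 < E) : h E = 0 := by simp [h, hE, hE.le]
lemma h_neg (E : ℝ) : h (-E) = 1 - h E := by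
  rcases lt_trichotomy E 0 with hE | hE | hE
  · rw [h_n hE, h_p (by linarith)]; ring
  · subst hE; simp [h]; norm_num
  · rw [h_p hE, h_n (by linarith)]; ring

lemma h_meas : Measurable h := by
  unfold h
  exact Measurable.ite measurableSet_Iio measurable_const
    (Measurable.ite measurableSet_Ioi measurable_const measurable_const)

lemma h_range (E : ℝ) : 0 ≤ h E ∧ h E ≤ 1 := by
  unfold h; split_ifs <;> norm_num

lemma fermi_range (β E : ℝ) : 0 ≤ fermi β E ∧ fermi β E ≤ 1 := by
  unfold fermi
  have := Real.exp_pos (β * E)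
  refine ⟨by positivity, ?_⟩
  rw [div_le_one (by positivity)]; linarith

lemma fermi_lim (E : ℝ) : Tendsto (fun β => fermi β E) atTop (𝓝 (h E)) := by
  unfold fermi
  rcases lt_trichotomy E 0 with hE | hE | hE
  · rw [h_n hE]
    have h1 : Tendsto (fun β : ℝ => Real.exp (β * E)) atTop (𝓝 0) :=
      Real.tendsto_exp_atBot.comp (tendsto_id.atTop_mul_const_of_neg hE)
    have h2 : Tendsto (fun β : ℝ => 1 / (1 + Real.exp (β * E))) atTop (𝓝 (1 / (1 + 0))) :=
      (tendsto_const_nhds (x := (1 : ℝ))).div (h1.const_add 1) (by norm_num)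
    simpa using h2
  · subst hE; simp [h]; norm_num
  · rw [h_p hE]
    have h1 : Tendsto (fun β : ℝ => Real.exp (β * E)) atTop atTop :=
      Real.tendsto_exp_atTop.comp (tendsto_id.atTop_mul_const hE)
    exact (tendsto_const_nhds (x := (1 : ℝ))).div_atTop (tendsto_atTop_add_const_left _ _ h1)

/-- Numerator built from occupation numbers. -/
def num (f : ℝ → ℝ) (p : ℝ × ℝ × ℝ × ℝ) : ℝ :=
  f ((0 + p.1 - p.2.2.1) * (0 + p.2.1 - p.2.2.2)) * (f (p.1 * p.2.1) - f (p.2.2.1 * p.2.2.2))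
    + f (p.1 * p.2.1) * (f (p.2.2.1 * p.2.2.2) - 1)

/-- Energy denominator. -/
def eps (p : ℝ × ℝ × ℝ × ℝ) : ℝ :=
  p.1 * p.2.1 - p.2.2.1 * p.2.2.2 - (0 + p.1 - p.2.2.1) * (0 + p.2.1 - p.2.2.2)

lemma num_bound (f : ℝ → ℝ) (hf : ∀ E, 0 ≤ f E ∧ f E ≤ 1) (p) : |num f p| ≤ 2 := by
  unfold num
  obtain ⟨a0, a1⟩ := hf ((0 + p.1 - p.2.2.1) * (0 + p.2.1 - p.2.2.2))
  obtain ⟨b0, b1⟩ := hf (p.1 * p.2.1)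
  obtain ⟨c0, c1⟩ := hf (p.2.2.1 * p.2.2.2)
  set a := f ((0 + p.1 - p.2.2.1) * (0 + p.2.1 - p.2.2.2))
  set b := f (p.1 * p.2.1)
  set c := f (p.2.2.1 * p.2.2.2)
  have h1 : |a * (b - c)| ≤ 1 := by
    rw [abs_mul]
    exact mul_le_one₀ (abs_le.2 ⟨by linarith, a1⟩) (abs_nonneg _)
      (abs_le.2 ⟨by linarith, by linarith⟩)
  have h2 : |b * (c - 1)| ≤ 1 := by
    rw [abs_mul]
    exact mul_le_one₀ (abs_le.2 ⟨by linarith, b1⟩) (abs_nonneg _)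
      (abs_le.2 ⟨by linarith, by linarith⟩)
  linarith [abs_add_le (a * (b - c)) (b * (c - 1))]

lemma num_meas (f : ℝ → ℝ) (hf : Measurable f) : Measurable (num f) := by
  unfold num; fun_prop

lemma eps_meas : Measurable eps := by unfold eps; fun_prop

lemma fermi_meas (β : ℝ) : Measurable (fermi β) := by unfold fermi; fun_prop

/-- Zero-temperature integrand. -/
noncomputable def G (q : ℝ) (p : ℝ × ℝ × ℝ × ℝ) : ℝ := num h p * Phi q (eps p)

lemma G_t1 (q a b c d : ℝ) : G q (-a, b, -c, d) = G q (a, b, c, d) := by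
  unfold G
  have e : eps (-a, b, -c, d) = - eps (a, b, c, d) := by simp only [eps]; ring
  rw [e, phi_neg]
  congr 1
  simp only [num]
  rw [show (0 + -a - -c) * (0 + b - d) = -((0 + a - c) * (0 + b - d)) by ring, h_neg, neg_mul,
    neg_mul, h_neg, h_neg]
  ring

lemma G_t2 (q a b c d : ℝ) : G q (a, -b, c, -d) = G q (a, b, c, d) := by
  unfold G
  have e : eps (a, -b, c, -d) = - eps (a, b, c, d) := by simp only [eps]; ring
  rw [e, phi_neg]
  congr 1
  simp only [num]
  rw [show (0 + a - c) * (0 + -b - -d) = -((0 + a - c) * (0 + b - d)) by ring, h_neg, mul_neg,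
    mul_neg, h_neg, h_neg]
  ring

/-- `B` transported to the variables `(x,y,x',y')`. -/
noncomputable def A (q : ℝ) (p : ℝ × ℝ × ℝ × ℝ) : ℝ := B q (-p.2.1, p.2.2.2, p.2.2.1, p.1)

lemma A_meas (q : ℝ) : StronglyMeasurable (A q) := (B_meas q).comp_measurable tI.measurable

lemma A_int (q : ℝ) : ∫ p, A q p ∂P = ∫ p, B q p ∂P := mp_int tI _ (B_meas q)

lemma A_zero (q a b c d : ℝ) (hh : 0 < b ∨ a < 0 ∨ c < 0 ∨ d < 0 ∨ c < a) :
    A q (a, b, c, d) = 0 := by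
  simp only [A, B]
  rw [if_neg]
  rintro ⟨h1, h2, h3, h4, h5⟩
  rcases hh with hh | hh | hh | hh | hh <;> linarith

lemma G_pos (q a b c d : ℝ) (ha : a ≠ 0) (hb : b ≠ 0) (hc : 0 < c) (hd : 0 < d)
    (hac : a ≠ c) (hbd : b ≠ d) :
    G q (a, b, c, d) = -(A q (a, b, c, d) + A q (b, a, d, c)) := by
  have hcd : h (c * d) = 0 := h_p (mul_pos hc hd)
  rcases lt_or_gt_of_ne ha with ha | ha <;> rcases lt_or_gt_of_ne hb with hb | hb
  · rw [A_zero _ _ _ _ _ (by tauto), A_zero _ _ _ _ _ (by tauto)]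
    simp [G, num, hcd, h_p (mul_pos_of_neg_of_neg ha hb)]
  · have hab : h (a * b) = 1 := h_n (mul_neg_of_neg_of_pos ha hb)
    rw [A_zero _ _ _ _ _ (by tauto)]
    rcases lt_or_gt_of_ne hbd with hbd | hbd
    · have he : h ((0 + a - c) * (0 + b - d)) = 0 :=
        h_p (mul_pos_of_neg_of_neg (by linarith) (by linarith))
      simp only [G, num, hcd, hab, he, A, B, eps]
      rw [if_pos ⟨by linarith, hc, hd, hb, hbd.le⟩, ← phi_neg]
      ring_nf
    · rw [A_zero _ _ _ _ _ (by tauto)]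
      have he : h ((0 + a - c) * (0 + b - d)) = 1 :=
        h_n (mul_neg_of_neg_of_pos (by linarith) (by linarith))
      simp [G, num, hcd, hab, he, - zero_add]
  · have hab : h (a * b) = 1 := h_n (mul_neg_of_pos_of_neg ha hb)
    rw [A_zero _ b a _ _ (by tauto)]
    rcases lt_or_gt_of_ne hac with hac | hac
    · have he : h ((0 + a - c) * (0 + b - d)) = 0 :=
        h_p (mul_pos_of_neg_of_neg (by linarith) (by linarith))
      simp only [G, num, hcd, hab, he, A, B, eps]
      rw [if_pos ⟨by linarith, hd, hc, ha, hac.le⟩, ← phi_neg]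
      ring_nf
    · rw [A_zero _ _ _ _ _ (by tauto)]
      have he : h ((0 + a - c) * (0 + b - d)) = 1 :=
        h_n (mul_neg_of_pos_of_neg (by linarith) (by linarith))
      simp [G, num, hcd, hab, he, - zero_add]
  · rw [A_zero _ _ _ _ _ (by tauto), A_zero _ _ _ _ _ (by tauto)]
    simp [G, num, hcd, h_p (mul_pos ha hb)]

/-- Sum of the two pieces. -/
noncomputable def D (q : ℝ) (p : ℝ × ℝ × ℝ × ℝ) : ℝ := A q p + A q (p.2.1, p.1, p.2.2.2, p.2.2.1)

lemma D_zero (q a b c d : ℝ) (hh : c < 0 ∨ d < 0) : D q (a, b, c, d) = 0 := by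
  simp only [D]
  rw [A_zero _ _ _ _ _ (by tauto), A_zero _ _ _ _ _ (by tauto)]; simp

lemma G_gen (q a b c d : ℝ) (ha : a ≠ 0) (hb : b ≠ 0) (hc : c ≠ 0) (hd : d ≠ 0)
    (hac : a ≠ c) (hbd : b ≠ d) :
    G q (a, b, c, d) =
      -(D q (a, b, c, d) + D q (-a, b, -c, d) + D q (a, -b, c, -d) + D q (-a, -b, -c, -d)) := by
  have key : ∀ a b c d : ℝ, a ≠ 0 → b ≠ 0 → 0 < c → 0 < d → a ≠ c → b ≠ d →
      G q (a, b, c, d) = - D q (a, b, c, d) := fun a b c d h1 h2 h3 h4 h5 h6 =>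
    G_pos q a b c d h1 h2 h3 h4 h5 h6
  have na := neg_ne_zero.2 ha
  have nb := neg_ne_zero.2 hb
  have nac : -a ≠ -c := fun h => hac (neg_injective h)
  have nbd : -b ≠ -d := fun h => hbd (neg_injective h)
  rcases lt_or_gt_of_ne hc with hc | hc <;> rcases lt_or_gt_of_ne hd with hd | hd
  · rw [D_zero _ a b c d (by tauto), D_zero _ (-a) b _ _ (Or.inr hd),
      D_zero _ a (-b) _ _ (Or.inl hc), ← G_t1, ← G_t2,
      key _ _ _ _ na nb (neg_pos.2 hc) (neg_pos.2 hd) nac nbd]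
    ring
  · rw [D_zero _ a b c d (by tauto), D_zero _ (-a) (-b) _ _ (Or.inr (neg_lt_zero.2 hd)),
      D_zero _ a (-b) _ _ (Or.inl hc), ← G_t1,
      key _ _ _ _ na hb (neg_pos.2 hc) hd nac hbd]
    ring
  · rw [D_zero _ a b c d (by tauto), D_zero _ (-a) (-b) _ _ (Or.inl (neg_lt_zero.2 hc)),
      D_zero _ (-a) b _ _ (Or.inr hd), ← G_t2,
      key _ _ _ _ ha nb hc (neg_pos.2 hd) hac nbd]
    ring
  · rw [D_zero _ a (-b) c _ (Or.inr (neg_lt_zero.2 hd)),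
      D_zero _ (-a) (-b) _ _ (Or.inl (neg_lt_zero.2 hc)),
      D_zero _ (-a) b _ _ (Or.inl (neg_lt_zero.2 hc)), 
      key _ _ _ _ ha hb hc hd hac hbd]
    ring

lemma ae1 {α : Type*} [MeasurableSpace α] (μ : Measure α) [SFinite μ] :
    ∀ᵐ p ∂(nu.prod μ), p.1 ≠ 0 :=
  Measure.quasiMeasurePreserving_fst.ae (p := fun x : ℝ => x ≠ 0) (Measure.ae_ne nu 0)

lemma ae_a : ∀ᵐ p ∂P, p.1 ≠ 0 := ae1 _
lemma ae_b : ∀ᵐ p ∂P, p.2.1 ≠ 0 := s1.quasiMeasurePreserving.ae ae_a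
lemma ae_c : ∀ᵐ p ∂P, p.2.2.1 ≠ 0 := s2.quasiMeasurePreserving.ae ae_b
lemma ae_d : ∀ᵐ p ∂P, p.2.2.2 ≠ 0 := s3.quasiMeasurePreserving.ae ae_c

lemma ae_ab : ∀ᵐ p ∂P, p.1 ≠ p.2.1 := by
  have hm : MeasurableSet {p : ℝ × ℝ × ℝ × ℝ | p.1 ≠ p.2.1} :=
    (measurableSet_eq_fun (by fun_prop) (by fun_prop)).compl
  unfold P
  rw [Measure.ae_prod_iff_ae_ae hm]
  refine Eventually.of_forall fun x => ?_
  exact Measure.quasiMeasurePreserving_fst.ae (p := fun y : ℝ => x ≠ y)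
    ((Measure.ae_ne nu x).mono fun y hy => hy.symm)
lemma ae_ac : ∀ᵐ p ∂P, p.1 ≠ p.2.2.1 := s2.quasiMeasurePreserving.ae ae_ab
lemma ae_bd : ∀ᵐ p ∂P, p.2.1 ≠ p.2.2.2 := tS.quasiMeasurePreserving.ae ae_ac

lemma G_int (q : ℝ) (hq : 0 < q) : ∫ p, G q p ∂P = -2 * Ifun q := by
  have hAi : ∀ T : ℝ × ℝ × ℝ × ℝ → ℝ × ℝ × ℝ × ℝ, Measurable T →
      Integrable (fun p => A q (T p)) P := fun T hT =>
    integrable_bdd _ _ ((A_meas q).comp_measurable hT) (1 / q ^ 2) (fun p => B_bound q hq _)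
  have hDm : StronglyMeasurable (D q) :=
    (A_meas q).add ((A_meas q).comp_measurable tS.measurable)
  have hDi : ∀ T : ℝ × ℝ × ℝ × ℝ → ℝ × ℝ × ℝ × ℝ, Measurable T →
      Integrable (fun p => D q (T p)) P := fun T hT =>
    (hAi T hT).add (hAi _ (tS.measurable.comp hT))
  have hD : ∫ p, D q p ∂P = 2 * ∫ p, B q p ∂P := by
    unfold D
    rw [integral_add (f := fun p => A q p) (hAi _ measurable_id) (hAi _ tS.measurable), mp_int tS _ (A_meas q), A_int]
    ring
  have e : ∫ p, G q p ∂P = ∫ p, -(D q p + D q (-p.1, p.2.1, -p.2.2.1, p.2.2.2)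
      + D q (p.1, -p.2.1, p.2.2.1, -p.2.2.2) + D q (-p.1, -p.2.1, -p.2.2.1, -p.2.2.2)) ∂P := by
    refine integral_congr_ae ?_
    filter_upwards [ae_a, ae_b, ae_c, ae_d, ae_ac, ae_bd] with p h1 h2 h3 h4 h5 h6
    exact G_gen q p.1 p.2.1 p.2.2.1 p.2.2.2 h1 h2 h3 h4 h5 h6
  have i0 : Integrable (fun p => D q p) P := hDi _ measurable_id
  have i1 := hDi _ t1.measurable
  have i2 := hDi _ t2.measurable
  have i3 := hDi _ t3.measurable
  have i01 : Integrable (fun p => D q p + D q (-p.1, p.2.1, -p.2.2.1, p.2.2.2)) P := i0.add i1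
  have i012 : Integrable (fun p => D q p + D q (-p.1, p.2.1, -p.2.2.1, p.2.2.2)
      + D q (p.1, -p.2.1, p.2.2.1, -p.2.2.2)) P := i01.add i2
  rw [e, integral_neg, integral_add i012 i3, integral_add i01 i2,
    integral_add i0 i1, mp_int t1 _ hDm, mp_int t2 _ hDm, mp_int t3 _ hDm, hD, Ifun_eq q hq]
  ring

lemma Sigma_im (β t : ℝ) (ht : 0 < t) :
    (Sigma2 β t 0 0).im = ∫ p, num (fermi β) p * (t / (eps p ^ 2 + t ^ 2)) ∂P := by
  set F : ℝ × ℝ × ℝ × ℝ → ℂ := fun p => ((num (fermi β) p : ℝ) : ℂ) /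
    (Complex.I * (t : ℂ) + ((eps p : ℝ) : ℂ)) with hF
  have hFm : StronglyMeasurable F := by
    apply Measurable.stronglyMeasurable
    have := num_meas _ (fermi_meas β)
    have := eps_meas
    rw [hF]; fun_prop
  have hFb : ∀ p, ‖F p‖ ≤ 2 / t := by
    intro p
    rw [hF]
    simp only [norm_div, Complex.norm_real]
    have h1 : t ≤ ‖Complex.I * (t : ℂ) + ((eps p : ℝ) : ℂ)‖ := by
      refine le_trans ?_ (Complex.abs_im_le_norm _)
      simp [le_abs_self]
    exact div_le_div₀ (by norm_num) (num_bound _ (fermi_range β) p) ht h1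
  have e : Sigma2 β t 0 0 = - ∫ p, F p ∂P := by
    rw [iter F hFm _ hFb]
    unfold Sigma2
    simp only [interval_nu]
    rfl
  have e2 : (∫ p, F p ∂P).im = ∫ p, (F p).im ∂P := by
    have := integral_im (integrable_bdd P F hFm _ hFb)
    exact this.symm
  rw [e, Complex.neg_im, e2, ← integral_neg]
  congr 1; ext p
  simp only [hF, Complex.div_im, Complex.normSq_apply]
  simp
  rw [← pow_two, ← pow_two, mul_div_assoc]

lemma Sigma_deriv (β q : ℝ) (hq : 0 < q) :
    deriv (fun t : ℝ => (Sigma2 β t 0 0).im) q = ∫ p, num (fermi β) p * Phi q (eps p) ∂P := by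
  have hn := num_meas _ (fermi_meas β)
  have he := eps_meas
  have hev : (fun t : ℝ => (Sigma2 β t 0 0).im) =ᶠ[𝓝 q]
      fun t => ∫ p, num (fermi β) p * (t / (eps p ^ 2 + t ^ 2)) ∂P := by
    filter_upwards [lt_mem_nhds hq] with t ht using Sigma_im β t ht
  rw [hev.deriv_eq]
  have hs : Ioi (q / 2) ∈ 𝓝 q := lt_mem_nhds (by linarith)
  refine (hasDerivAt_integral_of_dominated_loc_of_deriv_le (μ := P)
    (F := fun t p => num (fermi β) p * (t / (eps p ^ 2 + t ^ 2)))
    (F' := fun t p => num (fermi β) p * Phi t (eps p))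
    (bound := fun _ => 2 * (1 / (q / 2) ^ 2)) hs ?_ ?_ ?_ ?_ ?_ ?_).2.deriv
  · exact Eventually.of_forall fun t =>
      (Measurable.aestronglyMeasurable (by fun_prop))
  · refine integrable_bdd _ _ (Measurable.stronglyMeasurable (by fun_prop)) (2 * (1 / q)) ?_
    intro p
    rw [Real.norm_eq_abs, abs_mul]
    refine mul_le_mul (num_bound _ (fermi_range β) p) ?_ (abs_nonneg _) (by norm_num)
    rw [abs_of_nonneg (by positivity), div_le_div_iff₀ (by positivity) hq]
    nlinarith [sq_nonneg (eps p)]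
  · exact Measurable.aestronglyMeasurable (hn.mul ((phi_meas q).comp he))
  · refine Eventually.of_forall fun p t ht => ?_
    have ht : q / 2 < t := ht
    rw [Real.norm_eq_abs, abs_mul]
    refine mul_le_mul (num_bound _ (fermi_range β) p) ?_ (abs_nonneg _) (by norm_num)
    refine (phi_bound t (by linarith) _).trans ?_
    gcongr
  · exact integrable_const _
  · refine Eventually.of_forall fun p t ht => ?_
    have ht : q / 2 < t := ht
    have ht0 : 0 < t := by linarith
    have h0 : eps p ^ 2 + t ^ 2 ≠ 0 := by positivity
    have h1 := (hasDerivAt_id t).div (((hasDerivAt_id t).pow 2).const_add (eps p ^ 2)) h0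
    have h2 := h1.const_mul (num (fermi β) p)
    refine HasDerivAt.congr_deriv h2 ?_
    simp only [Phi, id]
    congr 2
    norm_num
    ring

lemma main (q : ℝ) (hq : 0 < q) :
    Tendsto (fun β : ℝ => deriv (fun t : ℝ => (Sigma2 β t 0 0).im) q) atTop
      (𝓝 (-2 * Ifun q)) := by
  simp only [Sigma_deriv _ q hq]
  rw [← G_int q hq]
  refine tendsto_integral_filter_of_dominated_convergence (fun _ => 2 * (1 / q ^ 2)) ?_ ?_
    (integrable_const _) ?_
  · exact Eventually.of_forall fun β => Measurable.aestronglyMeasurable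
      ((num_meas _ (fermi_meas β)).mul ((phi_meas q).comp eps_meas))
  · refine Eventually.of_forall fun β => Eventually.of_forall fun p => ?_
    rw [Real.norm_eq_abs, abs_mul]
    exact mul_le_mul (num_bound _ (fermi_range β) p) (phi_bound q hq _) (abs_nonneg _)
      (by norm_num)
  · refine Eventually.of_forall fun p => ?_
    refine Tendsto.mul_const _ ?_
    exact ((fermi_lim _).mul ((fermi_lim _).sub (fermi_lim _))).add
      ((fermi_lim _).mul ((fermi_lim _).sub tendsto_const_nhds))

end XY

/-- **Zero-temperature limit of the frequency derivative.** For every `q₀ > 0`,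
`lim_{β→∞} Im ∂Σ₂/∂q₀ (β, q₀, 0, 0) = -2 I(q₀)`. -/
theorem stmt_9 (q₀ : ℝ) (hq₀ : 0 < q₀) :
    Filter.Tendsto (fun β : ℝ => deriv (fun t : ℝ => (Sigma2 β t 0 0).im) q₀)
      Filter.atTop (nhds (-2 * Ifun q₀)) := by
  exact XY.main q₀ hq₀
end

section
/- Fix q₀ ∈ ℝ with q₀ ≠ 0. For β > 0 and (x, y, x', y') ∈ [−1,1]⁴ set E₁ = (x − x')(y − y') and ε = x y' + x' y − 2 x' y', and define ζ₂(β) = ∫_{[−1,1]⁴} (−E₁ δ_β'(E₁) − δ_β(E₁)) (f_β(x y) − f_β(x' y')) / (i q₀ + ε) dx dy dx' dy' and ζ₃(β) = ∫_{[−1,1]⁴} (−2 E₁ δ_β(E₁)) (f_β(x y) − f_β(x' y')) / (i q₀ + ε)² dx dy dx' dy'. Then ζ₂(β) → 0 and ζ₃(β) → 0 as β → ∞. -/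
/-- The approximate delta function `δ_β(E) = β/(4 cosh²(βE/2)) = -f_β'(E)`. -/
noncomputable def deltaB (β E : ℝ) : ℝ := β / (4 * (Real.cosh (β * E / 2)) ^ 2)

/-- `ζ₂(β) = ∫_{[-1,1]⁴} (-E₁ δ_β'(E₁) - δ_β(E₁)) (f_β(xy) - f_β(x'y')) / (i q₀ + ε)`,
with `E₁ = (x-x')(y-y')` and `ε = xy' + x'y - 2x'y'`. -/
noncomputable def zeta2 (q₀ β : ℝ) : ℂ :=
  ∫ x in (-1 : ℝ)..1, ∫ y in (-1 : ℝ)..1, ∫ x' in (-1 : ℝ)..1, ∫ y' in (-1 : ℝ)..1,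
    (((-((x - x') * (y - y') * deriv (fun E : ℝ => deltaB β E) ((x - x') * (y - y')))
        - deltaB β ((x - x') * (y - y'))) *
      (fermi β (x * y) - fermi β (x' * y')) : ℝ) : ℂ) /
    (Complex.I * (q₀ : ℂ) + ((x * y' + x' * y - 2 * x' * y' : ℝ) : ℂ))

/-- `ζ₃(β) = ∫_{[-1,1]⁴} (-2 E₁ δ_β(E₁)) (f_β(xy) - f_β(x'y')) / (i q₀ + ε)²`. -/
noncomputable def zeta3 (q₀ β : ℝ) : ℂ :=
  ∫ x in (-1 : ℝ)..1, ∫ y in (-1 : ℝ)..1, ∫ x' in (-1 : ℝ)..1, ∫ y' in (-1 : ℝ)..1,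
    (((-2 * ((x - x') * (y - y')) * deltaB β ((x - x') * (y - y'))) *
      (fermi β (x * y) - fermi β (x' * y')) : ℝ) : ℂ) /
    (Complex.I * (q₀ : ℂ) + ((x * y' + x' * y - 2 * x' * y' : ℝ) : ℂ)) ^ 2

open MeasureTheory Filter Topology

noncomputable def HB (β E : ℝ) : ℝ := E * deltaB β E

noncomputable def kB (β E : ℝ) : ℝ :=
  E * (β ^ 2 / 4 * (Real.sinh (β * E / 2) / (Real.cosh (β * E / 2)) ^ 3)) - deltaB β E

lemma deltaB_hasDerivAt (β E : ℝ) : HasDerivAt (fun E => deltaB β E)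
    (-(β ^ 2 / 4 * (Real.sinh (β * E / 2) / (Real.cosh (β * E / 2)) ^ 3))) E := by
  unfold deltaB
  have hc := (Real.cosh_pos (β * E / 2)).ne'
  have h1 : HasDerivAt (fun E : ℝ => β * E / 2) (β / 2) E := by
    simpa using ((hasDerivAt_id E).const_mul β).div_const 2
  have h2 := ((h1.cosh.pow 2).const_mul 4).fun_inv (by simp [hc]) |>.const_mul β
  have h3 := h2.congr_deriv (g' := -(β ^ 2 / 4 * (Real.sinh (β * E / 2) / (Real.cosh (β * E / 2)) ^ 3))) (by
    simp only [Pi.pow_apply]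
    field_simp
    ring)
  exact h3

lemma kB_eq (β E : ℝ) :
    -(E * deriv (fun E : ℝ => deltaB β E) E) - deltaB β E = kB β E := by
  rw [(deltaB_hasDerivAt β E).deriv, kB]; ring

lemma HB_hasDerivAt (β E : ℝ) : HasDerivAt (fun E => HB β E) (-(kB β E)) E := by
  have := (hasDerivAt_id E).mul (deltaB_hasDerivAt β E)
  refine this.congr_deriv ?_
  simp [kB]
  ring

lemma kB_neg (β E : ℝ) : kB β (-E) = kB β E := by
  simp [kB, deltaB, neg_div]

lemma abs_le_cosh (s : ℝ) : |s| ≤ Real.cosh s := by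
  rw [← Real.cosh_abs]
  exact (Real.self_le_sinh_iff.2 (abs_nonneg s)).trans (Real.sinh_lt_cosh _).le

lemma HB_eq (β E : ℝ) : HB β E = (β * E / 2) / (2 * (Real.cosh (β * E / 2)) ^ 2) := by
  unfold HB deltaB
  have hc := (Real.cosh_pos (β * E / 2)).ne'
  field_simp
  ring

lemma HB_abs_le (β E : ℝ) : |HB β E| ≤ 1 / 2 := by
  rw [HB_eq]
  set s := β * E / 2
  have hc := Real.one_le_cosh s
  have h := abs_le_cosh s
  rw [abs_div, abs_of_pos (show 0 < 2 * Real.cosh s ^ 2 by positivity), div_le_iff₀ (by positivity)]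
  nlinarith

lemma HB_abs_mul_le (β E : ℝ) : |HB β E| * |β * E| ≤ 1 := by
  have h0 := HB_eq β E
  have e : |β * E| = 2 * |β * E / 2| := by rw [abs_div]; norm_num; ring
  rw [e, h0]
  set s := β * E / 2
  have hc := Real.one_le_cosh s
  have h := abs_le_cosh s
  rw [abs_div, abs_of_pos (show 0 < 2 * Real.cosh s ^ 2 by positivity), div_mul_eq_mul_div, div_le_iff₀ (by positivity)]
  nlinarith [abs_nonneg s]

lemma HB_tendsto (E : ℝ) : Tendsto (fun β => HB β E) atTop (𝓝 0) := by
  by_cases hE : E = 0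
  · simp [HB, hE]
  have hE' : 0 < |E| := abs_pos.2 hE
  have h : Tendsto (fun β : ℝ => β⁻¹ * |E|⁻¹) atTop (𝓝 0) := by
    simpa using tendsto_inv_atTop_zero.mul_const (|E|⁻¹)
  refine squeeze_zero_norm' ?_ h
  filter_upwards [eventually_gt_atTop 0] with β hβ
  have := HB_abs_mul_le β E
  rw [abs_mul, abs_of_pos hβ] at this
  rw [Real.norm_eq_abs, ← mul_inv, ← one_div, le_div_iff₀ (by positivity)]
  exact this

lemma fermi_nonneg (β E : ℝ) : 0 ≤ fermi β E := by unfold fermi; positivity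

lemma fermi_le_one (β E : ℝ) : fermi β E ≤ 1 := by
  unfold fermi
  rw [div_le_one (by positivity)]
  linarith [Real.exp_pos (β * E)]

lemma fermi_sub_abs_le (β E E' : ℝ) : |fermi β E - fermi β E'| ≤ 1 := by
  rw [abs_le]
  constructor <;> linarith [fermi_nonneg β E, fermi_nonneg β E', fermi_le_one β E, fermi_le_one β E']

/-- positive case -/
lemma fd_pos (s t : ℝ) (hs : 0 ≤ s) (hst : s ≤ t) :
    |1 / (1 + Real.exp s) - 1 / (1 + Real.exp t)| * s ≤ t - s := by
  have hes : s + 1 ≤ Real.exp s := Real.add_one_le_exp s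
  have hm : Real.exp s ≤ Real.exp t := Real.exp_le_exp.2 hst
  have h0 : 0 < Real.exp s := Real.exp_pos s
  have h0t : 0 < Real.exp t := Real.exp_pos t
  have h1 : (s - t) + 1 ≤ Real.exp (s - t) := Real.add_one_le_exp _
  have h2 : Real.exp s = Real.exp (s - t) * Real.exp t := by rw [← Real.exp_add]; congr 1; ring
  have h3 : Real.exp t - Real.exp s ≤ (t - s) * Real.exp t := by rw [h2]; nlinarith
  have e : 1 / (1 + Real.exp s) - 1 / (1 + Real.exp t)
      = (Real.exp t - Real.exp s) / ((1 + Real.exp s) * (1 + Real.exp t)) := by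
    field_simp; ring
  rw [e, abs_of_nonneg (div_nonneg (by linarith) (by positivity)), div_mul_eq_mul_div,
    div_le_iff₀ (by positivity)]
  calc (Real.exp t - Real.exp s) * s ≤ ((t - s) * Real.exp t) * s := by gcongr
    _ = (t - s) * (s * Real.exp t) := by ring
    _ ≤ (t - s) * ((1 + Real.exp s) * (1 + Real.exp t)) := by
        apply mul_le_mul_of_nonneg_left _ (by linarith)
        nlinarith

lemma fd_neg_eq (s : ℝ) : 1 / (1 + Real.exp (-s)) = 1 - 1 / (1 + Real.exp s) := by
  rw [Real.exp_neg]
  have := Real.exp_pos s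
  field_simp
  ring

lemma fd_le (s t : ℝ) (hst : s ≤ t) :
    |1 / (1 + Real.exp s) - 1 / (1 + Real.exp t)| * min |s| |t| ≤ t - s := by
  rcases le_total 0 s with hs | hs
  · refine le_trans (mul_le_mul_of_nonneg_left (min_le_left _ _) (abs_nonneg _)) ?_
    rw [abs_of_nonneg hs]
    exact fd_pos s t hs hst
  · rcases le_total t 0 with ht | ht
    · refine le_trans (mul_le_mul_of_nonneg_left (min_le_right _ _) (abs_nonneg _)) ?_
      have := fd_pos (-t) (-s) (by linarith) (by linarith)
      rw [fd_neg_eq, fd_neg_eq] at this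
      rw [abs_of_nonpos ht]
      have e : 1 - 1 / (1 + Real.exp t) - (1 - 1 / (1 + Real.exp s)) =
        1 / (1 + Real.exp s) - 1 / (1 + Real.exp t) := by ring
      rw [e] at this
      linarith
    · have h1 : |1 / (1 + Real.exp s) - 1 / (1 + Real.exp t)| ≤ 1 := by
        have := fermi_sub_abs_le 1 s t
        simpa [fermi] using this
      have h2 : min |s| |t| ≤ t - s := (min_le_left _ _).trans (by rw [abs_of_nonpos hs]; linarith)
      have h3 : 0 ≤ min |s| |t| := by positivity
      nlinarith

lemma fd_le' (s t : ℝ) :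
    |1 / (1 + Real.exp s) - 1 / (1 + Real.exp t)| * min |s| |t| ≤ |s - t| := by
  rcases le_total s t with h | h
  · rw [abs_sub_comm s t, abs_of_nonneg (sub_nonneg.2 h)]; exact fd_le s t h
  · rw [abs_of_nonneg (sub_nonneg.2 h), abs_sub_comm, min_comm]; exact fd_le t s h

lemma fermi_sub_mul_le (β a b c : ℝ) :
    |fermi β (a * c) - fermi β (b * c)| * min |a| |b| ≤ |a - b| := by
  by_cases h : β * c = 0
  · have ha : β * (a * c) = 0 := by linear_combination a * h
    have hb : β * (b * c) = 0 := by linear_combination b * h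
    simp [fermi, ha, hb]
  have hp : 0 < |β * c| := abs_pos.2 h
  have := fd_le' (β * (a * c)) (β * (b * c))
  have ea : |β * (a * c)| = |a| * |β * c| := by rw [← abs_mul]; congr 1; ring
  have eb : |β * (b * c)| = |b| * |β * c| := by rw [← abs_mul]; congr 1; ring
  have ed : |β * (a * c) - β * (b * c)| = |a - b| * |β * c| := by rw [← abs_mul]; congr 1; ring
  rw [ea, eb, ed, ← min_mul_of_nonneg _ _ hp.le, ← mul_assoc] at this
  exact le_of_mul_le_mul_right this hp

/-- singular weight -/
noncomputable def wt (x : ℝ) : ℝ := |x| ^ (-(1 / 2) : ℝ)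

lemma wt_nonneg (x : ℝ) : 0 ≤ wt x := by unfold wt; positivity

lemma wt_sq (x : ℝ) (hx : x ≠ 0) : wt x ^ 2 * |x| = 1 := by
  have h : 0 < |x| := abs_pos.2 hx
  unfold wt
  rw [← Real.rpow_natCast, ← Real.rpow_mul h.le]
  norm_num
  rw [Real.rpow_neg_one]
  exact inv_mul_cancel₀ h.ne'

lemma fermi_wt (β a b c : ℝ) (ha : a ≠ 0) (hb : b ≠ 0) (hab : a - b ≠ 0) :
    |fermi β (a * c) - fermi β (b * c)| / |a - b| ≤ wt (a - b) * (wt a + wt b) := by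
  have h1 := fermi_sub_mul_le β a b c
  have h2 := fermi_sub_abs_le β (a * c) (b * c)
  set F := |fermi β (a * c) - fermi β (b * c)|
  have hF : 0 ≤ F := abs_nonneg _
  have hd : 0 < |a - b| := abs_pos.2 hab
  have key : ∀ x : ℝ, x ≠ 0 → F * |x| ≤ |a - b| → F / |a - b| ≤ wt (a - b) * wt x := by
    intro x hx h
    have hx' : 0 < |x| := abs_pos.2 hx
    have e1 := wt_sq (a - b) hab
    have e2 := wt_sq x hx
    refine le_of_sq_le_sq ?_ (mul_nonneg (wt_nonneg _) (wt_nonneg _))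
    have e3 : wt (a - b) ^ 2 = 1 / |a - b| := by rw [eq_div_iff hd.ne', e1]
    have e4 : wt x ^ 2 = 1 / |x| := by rw [eq_div_iff hx'.ne', e2]
    rw [mul_pow, e3, e4, div_pow, div_le_iff₀ (by positivity)]
    field_simp
    nlinarith
  rcases min_cases |a| |b| with ⟨h, _⟩ | ⟨h, _⟩ <;> rw [h] at h1
  · have := key a ha h1
    nlinarith [mul_nonneg (wt_nonneg (a - b)) (wt_nonneg b)]
  · have := key b hb h1
    nlinarith [mul_nonneg (wt_nonneg (a - b)) (wt_nonneg a)]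

noncomputable def mu : Measure ℝ := volume.restrict (Set.Ioc (-1) 1)

instance : IsFiniteMeasure mu := by unfold mu; infer_instance

lemma wt_neg (x : ℝ) : wt (-x) = wt x := by simp [wt]

lemma wt_int (R : ℝ) (hR : 0 < R) : Integrable ((Set.Ioc (-R) R).indicator wt) volume := by
  rw [integrable_indicator_iff measurableSet_Ioc,
    ← intervalIntegrable_iff_integrableOn_Ioc_of_le (by linarith)]
  apply intervalIntegrable_of_even (fun x => (wt_neg x).symm)
  · intro x hx
    refine IntervalIntegrable.congr ?_
      (intervalIntegral.intervalIntegrable_rpow' (r := -(1 / 2)) (by norm_num))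
    intro y hy
    rw [Set.uIoc_of_le hx.le] at hy
    simp [wt, abs_of_pos hy.1]

lemma W1_int : Integrable (fun q : ℝ × ℝ => wt (q.1 - q.2) * wt q.2) (mu.prod mu) := by
  have h := (wt_int 1 one_pos).convolution_integrand (ContinuousLinearMap.mul ℝ ℝ) (wt_int 2 two_pos)
  unfold mu
  rw [Measure.prod_restrict]
  refine (h.integrableOn (s := Set.Ioc (-1) 1 ×ˢ Set.Ioc (-1) 1)).congr ?_
  refine (ae_restrict_iff' (measurableSet_Ioc.prod measurableSet_Ioc)).2 (Eventually.of_forall ?_)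
  rintro ⟨x, y⟩ ⟨hx, hy⟩
  simp only [Set.mem_Ioc] at hx hy
  have h1 : y ∈ Set.Ioc (-1 : ℝ) 1 := hy
  have h2 : x - y ∈ Set.Ioc (-2 : ℝ) 2 := ⟨by linarith, by linarith⟩
  simp only [Set.indicator_of_mem h1, Set.indicator_of_mem h2, ContinuousLinearMap.mul_apply']
  ring

lemma W2_int : Integrable (fun q : ℝ × ℝ => wt (q.1 - q.2) * (wt q.1 + wt q.2)) (mu.prod mu) := by
  refine (W1_int.swap.add W1_int).congr (Eventually.of_forall ?_)
  rintro ⟨x, y⟩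
  simp only [Pi.add_apply, Function.comp_apply, Prod.swap_prod_mk]
  rw [← neg_sub x y, wt_neg]
  ring

noncomputable def nu : Measure (ℝ × ℝ × ℝ) := mu.prod (mu.prod mu)

instance : IsFiniteMeasure nu := by unfold nu; infer_instance

lemma W3_int : Integrable (fun q : ℝ × ℝ × ℝ =>
    wt (q.1 - q.2.2) * (wt q.1 + wt q.2.2)) nu := by
  have h1 := W2_int.comp_fst mu
  have m1 : MeasurePreserving (Prod.map id Prod.swap : ℝ × ℝ × ℝ → ℝ × ℝ × ℝ)
      (mu.prod (mu.prod mu)) (mu.prod (mu.prod mu)) :=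
    (MeasurePreserving.id mu).prod Measure.measurePreserving_swap
  have m2 := (measurePreserving_prodAssoc mu mu mu).symm
  have := (m2.comp m1).integrable_comp_of_integrable h1
  exact this

lemma nu_ae : ∀ᵐ q ∂nu, (q.1 ∈ Set.Ioc (-1 : ℝ) 1 ∧ q.2.1 ∈ Set.Ioc (-1 : ℝ) 1 ∧
    q.2.2 ∈ Set.Ioc (-1 : ℝ) 1) := by
  unfold nu mu
  rw [Measure.prod_restrict, Measure.prod_restrict]
  exact ae_restrict_mem (measurableSet_Ioc.prod (measurableSet_Ioc.prod measurableSet_Ioc))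

lemma mu_ne : ∀ᵐ x ∂mu, x ≠ 0 := by
  unfold mu
  exact ae_restrict_of_ae (Measure.ae_ne volume 0)

lemma nu_ne : ∀ᵐ q ∂nu, q.1 ≠ 0 ∧ q.2.2 ≠ 0 := by
  have h1 : ∀ᵐ q ∂nu, q.1 ≠ 0 := Measure.quasiMeasurePreserving_fst.ae mu_ne
  have h2 : ∀ᵐ q ∂nu, q.2.2 ≠ 0 :=
    Measure.quasiMeasurePreserving_snd.ae (Measure.quasiMeasurePreserving_snd.ae mu_ne)
  exact h1.and h2

lemma den_re_im (q₀ s : ℝ) : |q₀| ≤ ‖Complex.I * (q₀ : ℂ) + (s : ℂ)‖ := by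
  have := Complex.abs_im_le_norm (Complex.I * (q₀ : ℂ) + (s : ℂ))
  simpa using this

lemma den_ne (q₀ s : ℝ) (hq : q₀ ≠ 0) : Complex.I * (q₀ : ℂ) + (s : ℂ) ≠ 0 := by
  have := den_re_im q₀ s
  rw [← norm_pos_iff]
  exact (abs_pos.2 hq).trans_le this

lemma den_ne' (q₀ : ℝ) (hq : q₀ ≠ 0) (s : ℝ) : Complex.I * (q₀ : ℂ) + (s : ℂ) ≠ 0 :=
  den_ne q₀ s hq

lemma deltaB_cont (β : ℝ) : Continuous (fun E => deltaB β E) := by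
  unfold deltaB
  refine Continuous.div (by fun_prop) (by fun_prop) fun x => ?_
  have := Real.cosh_pos (β * x / 2)
  positivity

lemma HB_cont (β : ℝ) : Continuous (fun E => HB β E) := by
  unfold HB
  exact continuous_id.mul (deltaB_cont β)

lemma kB_cont (β : ℝ) : Continuous (fun E => kB β E) := by
  unfold kB
  refine Continuous.sub (continuous_id.mul (continuous_const.mul (Continuous.div (by fun_prop) (by fun_prop) fun x => ?_))) (deltaB_cont β)
  have := Real.cosh_pos (β * x / 2)
  positivity

lemma fermi_cont (β : ℝ) : Continuous (fun E => fermi β E) := by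
  unfold fermi
  refine Continuous.div (by fun_prop) (by fun_prop) fun x => ?_
  positivity

noncomputable def Gf (q₀ p r t : ℝ) : ℂ := (Complex.I * (q₀ : ℂ) + ((p * t + r : ℝ) : ℂ))⁻¹

noncomputable def Gd (q₀ p r t : ℝ) : ℂ :=
  -(p : ℂ) / (Complex.I * (q₀ : ℂ) + ((p * t + r : ℝ) : ℂ)) ^ 2

lemma Gf_deriv (q₀ p r t : ℝ) (hq : q₀ ≠ 0) :
    HasDerivAt (fun t => Gf q₀ p r t) (Gd q₀ p r t) t := by
  have h : HasDerivAt (fun t : ℝ => p * t + r) p t := by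
    simpa using ((hasDerivAt_id t).const_mul p).add_const r
  have h2 := (h.ofReal_comp.const_add (Complex.I * (q₀ : ℂ))).fun_inv (den_ne q₀ _ hq)
  exact h2

lemma Gf_norm (q₀ p r t : ℝ) (hq : q₀ ≠ 0) : ‖Gf q₀ p r t‖ ≤ |q₀|⁻¹ := by
  unfold Gf
  rw [norm_inv]
  exact inv_anti₀ (abs_pos.2 hq) (den_re_im _ _)

lemma Gd_norm (q₀ p r t : ℝ) (hq : q₀ ≠ 0) (hp : |p| ≤ 3) : ‖Gd q₀ p r t‖ ≤ 3 / |q₀| ^ 2 := by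
  unfold Gd
  rw [norm_div, norm_neg, norm_pow, Complex.norm_real, Real.norm_eq_abs]
  have := abs_pos.2 hq
  have := den_re_im q₀ (p * t + r)
  gcongr

lemma Gd_cont (q₀ p r : ℝ) (hq : q₀ ≠ 0) : Continuous (fun t => Gd q₀ p r t) := by
  unfold Gd
  refine Continuous.div (by fun_prop) (by fun_prop) fun t => pow_ne_zero _ (den_ne q₀ _ hq)

lemma Gf_cont (q₀ p r : ℝ) (hq : q₀ ≠ 0) : Continuous (fun t => Gf q₀ p r t) := by
  unfold Gf
  refine Continuous.inv₀ (by fun_prop) fun t => (den_ne q₀ _ hq)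

noncomputable def K1 (q₀ p r β v c : ℝ) : ℂ :=
  ∫ t in (-1 : ℝ)..1, ((kB β (v * (t - c)) : ℝ) : ℂ) * Gf q₀ p r t

noncomputable def K2 (q₀ p r β v c : ℝ) : ℂ :=
  ∫ t in (-1 : ℝ)..1, ((HB β (v * (t - c)) : ℝ) : ℂ) * Gd q₀ p r t

lemma K1_eq (q₀ p r β v c : ℝ) (hq : q₀ ≠ 0) :
    (v : ℂ) * K1 q₀ p r β v c = -(((HB β (v * (1 - c)) : ℝ) : ℂ) * Gf q₀ p r 1
      - ((HB β (v * (-1 - c)) : ℝ) : ℂ) * Gf q₀ p r (-1) - K2 q₀ p r β v c) := by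
  have hu : ∀ t : ℝ, HasDerivAt (fun t : ℝ => ((HB β (v * (t - c)) : ℝ) : ℂ))
      (((-(kB β (v * (t - c))) * v : ℝ)) : ℂ) t := by
    intro t
    have h : HasDerivAt (fun t : ℝ => v * (t - c)) v t := by
      simpa using ((hasDerivAt_id t).sub_const c).const_mul v
    exact ((HB_hasDerivAt β (v * (t - c))).comp t h).ofReal_comp
  have hk : Continuous fun t : ℝ => (((-(kB β (v * (t - c))) * v : ℝ)) : ℂ) := by
    have := (kB_cont β).comp (show Continuous fun t : ℝ => v * (t - c) by fun_prop)
    exact Complex.continuous_ofReal.comp (this.neg.mul continuous_const)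
  have := intervalIntegral.integral_mul_deriv_eq_deriv_mul (a := -1) (b := 1)
    (fun t _ => hu t) (fun t _ => Gf_deriv q₀ p r t hq)
    (hk.intervalIntegrable _ _) ((Gd_cont q₀ p r hq).intervalIntegrable _ _)
  have e : ∫ t in (-1 : ℝ)..1, (((-(kB β (v * (t - c))) * v : ℝ)) : ℂ) * Gf q₀ p r t
      = -((v : ℂ) * K1 q₀ p r β v c) := by
    rw [K1, ← intervalIntegral.integral_const_mul, ← intervalIntegral.integral_neg]
    congr 1; ext t; push_cast; ring
  rw [e] at this
  rw [K2, this]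
  ring

lemma HG_norm (q₀ p r β E t : ℝ) (hq : q₀ ≠ 0) :
    ‖((HB β E : ℝ) : ℂ) * Gf q₀ p r t‖ ≤ 1 / 2 * |q₀|⁻¹ := by
  rw [norm_mul, Complex.norm_real, Real.norm_eq_abs]
  exact mul_le_mul (HB_abs_le _ _) (Gf_norm q₀ p r t hq) (norm_nonneg _) (by norm_num)

lemma HGd_norm (q₀ p r β E t : ℝ) (hq : q₀ ≠ 0) (hp : |p| ≤ 3) :
    ‖((HB β E : ℝ) : ℂ) * Gd q₀ p r t‖ ≤ 1 / 2 * (3 / |q₀| ^ 2) := by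
  rw [norm_mul, Complex.norm_real, Real.norm_eq_abs]
  exact mul_le_mul (HB_abs_le _ _) (Gd_norm q₀ p r t hq hp) (norm_nonneg _) (by norm_num)

lemma K2_norm (q₀ p r β v c : ℝ) (hq : q₀ ≠ 0) (hp : |p| ≤ 3) :
    ‖K2 q₀ p r β v c‖ ≤ 3 / |q₀| ^ 2 := by
  have := intervalIntegral.norm_integral_le_of_norm_le_const (a := (-1 : ℝ)) (b := 1)
    (f := fun t => ((HB β (v * (t - c)) : ℝ) : ℂ) * Gd q₀ p r t)
    (fun t _ => HGd_norm q₀ p r β (v * (t - c)) t hq hp)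
  refine this.trans (le_of_eq ?_)
  norm_num
  ring

lemma K2_tendsto (q₀ p r v c : ℝ) (hq : q₀ ≠ 0) (hp : |p| ≤ 3) :
    Tendsto (fun β => K2 q₀ p r β v c) atTop (𝓝 0) := by
  have h := intervalIntegral.tendsto_integral_filter_of_dominated_convergence (μ := volume)
    (a := (-1 : ℝ)) (b := 1) (l := atTop)
    (F := fun (β t : ℝ) => ((HB β (v * (t - c)) : ℝ) : ℂ) * Gd q₀ p r t) (f := fun _ => 0)
    (fun _ => 1 / 2 * (3 / |q₀| ^ 2)) ?_ ?_ ?_ ?_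
  · simpa [K2] using h
  · refine Eventually.of_forall fun β => Continuous.aestronglyMeasurable ?_
    have := (HB_cont β).comp (show Continuous fun t : ℝ => v * (t - c) by fun_prop)
    exact (Complex.continuous_ofReal.comp this).mul (Gd_cont q₀ p r hq)
  · exact Eventually.of_forall fun β => Eventually.of_forall fun t _ => HGd_norm _ _ _ _ _ _ hq hp
  · exact intervalIntegrable_const
  · refine Eventually.of_forall fun t _ => ?_
    have := ((Complex.continuous_ofReal.tendsto 0).comp (HB_tendsto (v * (t - c)))).mul_const
      (Gd q₀ p r t)
    simpa using this

lemma K1_norm (q₀ p r β v c : ℝ) (hq : q₀ ≠ 0) (hp : |p| ≤ 3) :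
    |v| * ‖K1 q₀ p r β v c‖ ≤ |q₀|⁻¹ + 3 / |q₀| ^ 2 := by
  have e := congrArg norm (K1_eq q₀ p r β v c hq)
  rw [norm_mul, Complex.norm_real, Real.norm_eq_abs, norm_neg] at e
  rw [e]
  refine (norm_sub_le _ _).trans (add_le_add ((norm_sub_le _ _).trans ?_) (K2_norm _ _ _ _ _ _ hq hp))
  linarith [HG_norm q₀ p r β (v * (1 - c)) 1 hq, HG_norm q₀ p r β (v * (-1 - c)) (-1) hq]

lemma K1_tendsto (q₀ p r v c : ℝ) (hq : q₀ ≠ 0) (hp : |p| ≤ 3) (hv : v ≠ 0) :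
    Tendsto (fun β => K1 q₀ p r β v c) atTop (𝓝 0) := by
  have hH : ∀ E t : ℝ, Tendsto (fun β => ((HB β E : ℝ) : ℂ) * Gf q₀ p r t) atTop (𝓝 0) := by
    intro E t
    simpa using ((Complex.continuous_ofReal.tendsto 0).comp (HB_tendsto E)).mul_const (Gf q₀ p r t)
  have h := ((((hH (v * (1 - c)) 1).sub (hH (v * (-1 - c)) (-1))).sub
    (K2_tendsto q₀ p r v c hq hp)).neg).const_mul ((v : ℂ)⁻¹)
  simp only [sub_zero, neg_zero, mul_zero] at h
  refine h.congr fun β => ?_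
  rw [← K1_eq q₀ p r β v c hq, ← mul_assoc, inv_mul_cancel₀ (by exact_mod_cast hv), one_mul]

/-- core dominated convergence -/
lemma core (q₀ : ℝ) (hq : q₀ ≠ 0) (p r : ℝ × ℝ × ℝ → ℝ) (hpc : Continuous p) (hrc : Continuous r)
    (hp : ∀ a c b : ℝ, a ∈ Set.Ioc (-1 : ℝ) 1 → c ∈ Set.Ioc (-1 : ℝ) 1 → b ∈ Set.Ioc (-1 : ℝ) 1 →
      |p (a, c, b)| ≤ 3) :
    Tendsto (fun β => ∫ q, ((fermi β (q.1 * q.2.1) - fermi β (q.2.2 * q.2.1) : ℝ) : ℂ) *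
      K1 q₀ (p q) (r q) β (q.1 - q.2.2) q.2.1 ∂nu) atTop (𝓝 0) := by
  have h := tendsto_integral_filter_of_dominated_convergence (μ := nu) (l := atTop)
    (F := fun (β : ℝ) q => ((fermi β (q.1 * q.2.1) - fermi β (q.2.2 * q.2.1) : ℝ) : ℂ) *
      K1 q₀ (p q) (r q) β (q.1 - q.2.2) q.2.1) (f := fun _ => 0)
    (fun q => (wt (q.1 - q.2.2) * (wt q.1 + wt q.2.2)) * (|q₀|⁻¹ + 3 / |q₀| ^ 2)) ?_ ?_ ?_ ?_
  · simpa using h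
  · refine Eventually.of_forall fun β => Continuous.aestronglyMeasurable ?_
    refine Continuous.mul ?_ ?_
    · exact Complex.continuous_ofReal.comp
        (((fermi_cont β).comp (by fun_prop)).sub ((fermi_cont β).comp (by fun_prop)))
    · unfold K1
      refine intervalIntegral.continuous_parametric_intervalIntegral_of_continuous' ?_ _ _
      refine Continuous.mul (Complex.continuous_ofReal.comp ((kB_cont β).comp (by fun_prop))) ?_
      unfold Gf
      refine Continuous.inv₀ (by fun_prop) fun t => (den_ne q₀ _ hq)
  · refine Eventually.of_forall fun β => ?_
    filter_upwards [nu_ae, nu_ne] with q hq1 hq2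
    obtain ⟨a, c, b⟩ := q
    simp only at hq1 hq2 ⊢
    have hP := hp a c b hq1.1 hq1.2.1 hq1.2.2
    have hN := K1_norm q₀ (p (a, c, b)) (r (a, c, b)) β (a - b) c hq hP
    by_cases hab : a - b = 0
    · have : a = b := by linarith
      subst this
      simp only [sub_self, Complex.ofReal_zero, zero_mul, norm_zero]
      have := wt_nonneg 0
      have := wt_nonneg a
      positivity
    · have hF := fermi_wt β a b c hq2.1 hq2.2 hab
      rw [norm_mul, Complex.norm_real, Real.norm_eq_abs]
      have hd : 0 < |a - b| := abs_pos.2 hab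
      calc _ = (|fermi β (a * c) - fermi β (b * c)| / |a - b|) *
            (|a - b| * ‖K1 q₀ (p (a, c, b)) (r (a, c, b)) β (a - b) c‖) := by
              field_simp
        _ ≤ _ := mul_le_mul hF hN (by positivity)
              (mul_nonneg (wt_nonneg _) (add_nonneg (wt_nonneg _) (wt_nonneg _)))
  · exact W3_int.mul_const _
  · filter_upwards [nu_ae] with q hq1
    obtain ⟨a, c, b⟩ := q
    simp only at hq1 ⊢
    have hP := hp a c b hq1.1 hq1.2.1 hq1.2.2
    by_cases hab : a - b = 0
    · have : a = b := by linarith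
      subst this
      simp
    · refine squeeze_zero_norm (fun β => ?_)
        (tendsto_zero_iff_norm_tendsto_zero.1 (K1_tendsto q₀ (p (a, c, b)) (r (a, c, b)) (a - b) c hq hP hab))
      rw [norm_mul, Complex.norm_real, Real.norm_eq_abs]
      exact mul_le_of_le_one_left (norm_nonneg _) (fermi_sub_abs_le _ _ _)

lemma ii_mu (f : ℝ → ℂ) : ∫ x in (-1 : ℝ)..1, f x = ∫ x, f x ∂mu := by
  rw [intervalIntegral.integral_of_le (by norm_num)]; rfl

lemma int2 (Φ : ℝ × ℝ → ℂ) (h : Continuous Φ) : Integrable Φ (mu.prod mu) := by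
  unfold mu
  rw [Measure.prod_restrict]
  exact (h.continuousOn.integrableOn_compact (isCompact_Icc.prod isCompact_Icc)).mono_set
    (Set.prod_mono Set.Ioc_subset_Icc_self Set.Ioc_subset_Icc_self)

lemma int3 (Φ : ℝ × ℝ × ℝ → ℂ) (h : Continuous Φ) : Integrable Φ nu := by
  unfold nu mu
  rw [Measure.prod_restrict, Measure.prod_restrict]
  exact (h.continuousOn.integrableOn_compact
    (isCompact_Icc.prod (isCompact_Icc.prod isCompact_Icc))).mono_set
    (Set.prod_mono Set.Ioc_subset_Icc_self
      (Set.prod_mono Set.Ioc_subset_Icc_self Set.Ioc_subset_Icc_self))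

lemma int4 (Φ : ℝ × ℝ × ℝ × ℝ → ℂ) (h : Continuous Φ) : Integrable Φ (mu.prod nu) := by
  unfold nu mu
  rw [Measure.prod_restrict, Measure.prod_restrict, Measure.prod_restrict]
  exact (h.continuousOn.integrableOn_compact
    (isCompact_Icc.prod (isCompact_Icc.prod (isCompact_Icc.prod isCompact_Icc)))).mono_set
    (Set.prod_mono Set.Ioc_subset_Icc_self (Set.prod_mono Set.Ioc_subset_Icc_self
      (Set.prod_mono Set.Ioc_subset_Icc_self Set.Ioc_subset_Icc_self)))

lemma I2 (Φ : ℝ × ℝ → ℂ) (h : Continuous Φ) :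
    ∫ x in (-1 : ℝ)..1, ∫ y in (-1 : ℝ)..1, Φ (x, y) = ∫ q, Φ q ∂(mu.prod mu) := by
  rw [integral_prod _ (int2 Φ h)]
  simp only [ii_mu]

lemma I3 (Φ : ℝ × ℝ × ℝ → ℂ) (h : Continuous Φ) :
    ∫ x in (-1 : ℝ)..1, ∫ y in (-1 : ℝ)..1, ∫ z in (-1 : ℝ)..1, Φ (x, y, z) = ∫ q, Φ q ∂nu := by
  have e := integral_prod _ (int3 Φ h)
  unfold nu
  rw [e, ii_mu]
  congr 1; ext x
  exact I2 (fun q => Φ (x, q)) (by fun_prop)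

lemma I4 (Φ : ℝ × ℝ × ℝ × ℝ → ℂ) (h : Continuous Φ) :
    ∫ x in (-1 : ℝ)..1, ∫ y in (-1 : ℝ)..1, ∫ z in (-1 : ℝ)..1, ∫ w in (-1 : ℝ)..1,
      Φ (x, y, z, w) = ∫ q, Φ q ∂(mu.prod nu) := by
  rw [integral_prod _ (int4 Φ h), ii_mu]
  congr 1; ext x
  exact I3 (fun q => Φ (x, q)) (by fun_prop)

noncomputable def E1 (q : ℝ × ℝ × ℝ × ℝ) : ℝ := (q.1 - q.2.2.1) * (q.2.1 - q.2.2.2)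

noncomputable def dn (q₀ : ℝ) (q : ℝ × ℝ × ℝ × ℝ) : ℂ :=
  Complex.I * (q₀ : ℂ) +
    ((q.1 * q.2.2.2 + q.2.2.1 * q.2.1 - 2 * q.2.2.1 * q.2.2.2 : ℝ) : ℂ)

lemma E1_cont : Continuous E1 := by unfold E1; fun_prop

lemma dn_cont (q₀ : ℝ) : Continuous (dn q₀) := by unfold dn; fun_prop

lemma dn_ne (q₀ : ℝ) (hq : q₀ ≠ 0) (q : ℝ × ℝ × ℝ × ℝ) : dn q₀ q ≠ 0 := den_ne q₀ _ hq

noncomputable def A1 (q₀ β : ℝ) (q : ℝ × ℝ × ℝ × ℝ) : ℂ :=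
  ((kB β (E1 q) * (fermi β (q.1 * q.2.1) - fermi β (q.2.2.1 * q.2.1)) : ℝ) : ℂ) / dn q₀ q

noncomputable def A2 (q₀ β : ℝ) (q : ℝ × ℝ × ℝ × ℝ) : ℂ :=
  ((kB β (E1 q) * (fermi β (q.2.2.1 * q.2.1) - fermi β (q.2.2.1 * q.2.2.2)) : ℝ) : ℂ) / dn q₀ q

lemma A1_cont (q₀ β : ℝ) (hq : q₀ ≠ 0) : Continuous (A1 q₀ β) := by
  unfold A1
  refine Continuous.div (Complex.continuous_ofReal.comp (((kB_cont β).comp E1_cont).mul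
    (((fermi_cont β).comp (by fun_prop)).sub ((fermi_cont β).comp (by fun_prop)))))
    (dn_cont q₀) (dn_ne q₀ hq)

lemma A2_cont (q₀ β : ℝ) (hq : q₀ ≠ 0) : Continuous (A2 q₀ β) := by
  unfold A2
  refine Continuous.div (Complex.continuous_ofReal.comp (((kB_cont β).comp E1_cont).mul
    (((fermi_cont β).comp (by fun_prop)).sub ((fermi_cont β).comp (by fun_prop)))))
    (dn_cont q₀) (dn_ne q₀ hq)

lemma zeta2_eq (q₀ β : ℝ) (hq : q₀ ≠ 0) :
    zeta2 q₀ β = ∫ q, A1 q₀ β q ∂(mu.prod nu) + ∫ q, A2 q₀ β q ∂(mu.prod nu) := by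
  have h1 := A1_cont q₀ β hq
  have h2 := A2_cont q₀ β hq
  rw [← integral_add (int4 _ h1) (int4 _ h2), ← I4 (fun q => A1 q₀ β q + A2 q₀ β q) (h1.add h2)]
  unfold zeta2
  simp only [kB_eq, A1, A2, dn, E1, ← add_div, ← Complex.ofReal_add, ← mul_add, sub_add_sub_cancel]

lemma A1_int (q₀ β : ℝ) (hq : q₀ ≠ 0) :
    ∫ q, A1 q₀ β q ∂(mu.prod nu) =
      ∫ q, ((fermi β (q.1 * q.2.1) - fermi β (q.2.2 * q.2.1) : ℝ) : ℂ) *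
      K1 q₀ (q.1 - 2 * q.2.2) (q.2.2 * q.2.1) β (q.1 - q.2.2) q.2.1 ∂nu := by
  have h1 := A1_cont q₀ β hq
  rw [← I4 _ h1, I3 (fun q => ∫ w in (-1 : ℝ)..1, A1 q₀ β (q.1, q.2.1, q.2.2, w))]
  · congr 1; ext q
    obtain ⟨x, y, x'⟩ := q
    rw [K1, ← intervalIntegral.integral_const_mul]
    congr 1; ext t
    simp only [A1, E1, dn, Gf]
    rw [← kB_neg β ((x - x') * (t - y)), div_eq_mul_inv]
    have e1 : -((x - x') * (t - y)) = (x - x') * (y - t) := by ring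
    have e2 : (x - 2 * x') * t + x' * y = x * t + x' * y - 2 * x' * t := by ring
    rw [e1, e2, Complex.ofReal_mul]
    ring
  · refine intervalIntegral.continuous_parametric_intervalIntegral_of_continuous' ?_ _ _
    exact h1.comp (by fun_prop)

lemma A2_int (q₀ β : ℝ) (hq : q₀ ≠ 0) :
    ∫ q, A2 q₀ β q ∂(mu.prod nu) =
      ∫ q, ((fermi β (q.1 * q.2.1) - fermi β (q.2.2 * q.2.1) : ℝ) : ℂ) *
      K1 q₀ q.2.2 (q.2.1 * q.1 - 2 * q.2.1 * q.2.2) β (q.1 - q.2.2) q.2.1 ∂nu := by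
  have h1 := A2_cont q₀ β hq
  rw [integral_prod_symm _ (int4 _ h1)]
  congr 1; ext q
  obtain ⟨y, x', y'⟩ := q
  rw [K1, ← intervalIntegral.integral_const_mul, ii_mu]
  congr 1; ext t
  simp only [A2, E1, dn, Gf]
  have e1 : (y - y') * (t - x') = (t - x') * (y - y') := by ring
  have e2 : y' * t + (x' * y - 2 * x' * y') = t * y' + x' * y - 2 * x' * y' := by ring
  rw [e1, e2, Complex.ofReal_mul, div_eq_mul_inv, mul_comm y x', mul_comm y' x']
  ring

lemma zeta2_tendsto (q₀ : ℝ) (hq : q₀ ≠ 0) : Tendsto (fun β => zeta2 q₀ β) atTop (𝓝 0) := by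
  have t1 := core q₀ hq (fun q => q.1 - 2 * q.2.2) (fun q => q.2.2 * q.2.1)
    (by fun_prop) (by fun_prop) (by
      intro a c b ha _ hb
      simp only [Set.mem_Ioc] at ha hb
      rw [abs_le]
      constructor <;> simp only <;> linarith)
  have t2 := core q₀ hq (fun q => q.2.2) (fun q => q.2.1 * q.1 - 2 * q.2.1 * q.2.2)
    (by fun_prop) (by fun_prop) (by
      intro a c b _ _ hb
      simp only [Set.mem_Ioc] at hb
      rw [abs_le]
      constructor <;> simp only <;> linarith)
  have t := t1.add t2
  rw [add_zero] at t
  refine t.congr fun β => ?_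
  rw [zeta2_eq q₀ β hq, A1_int q₀ β hq, A2_int q₀ β hq]

noncomputable def A3 (q₀ β : ℝ) (q : ℝ × ℝ × ℝ × ℝ) : ℂ :=
  ((-2 * HB β (E1 q) * (fermi β (q.1 * q.2.1) - fermi β (q.2.2.1 * q.2.2.2)) : ℝ) : ℂ) /
    dn q₀ q ^ 2

lemma A3_cont (q₀ β : ℝ) (hq : q₀ ≠ 0) : Continuous (A3 q₀ β) := by
  unfold A3
  refine Continuous.div (Complex.continuous_ofReal.comp
    ((continuous_const.mul ((HB_cont β).comp E1_cont)).mul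
    (((fermi_cont β).comp (by fun_prop)).sub ((fermi_cont β).comp (by fun_prop)))))
    ((dn_cont q₀).pow 2) (fun q => pow_ne_zero _ (dn_ne q₀ hq q))

lemma zeta3_eq (q₀ β : ℝ) (hq : q₀ ≠ 0) :
    zeta3 q₀ β = ∫ q, A3 q₀ β q ∂(mu.prod nu) := by
  rw [← I4 _ (A3_cont q₀ β hq)]
  unfold zeta3
  simp only [A3, HB, dn, E1, mul_assoc]

lemma A3_norm (q₀ β : ℝ) (hq : q₀ ≠ 0) (q : ℝ × ℝ × ℝ × ℝ) :
    ‖A3 q₀ β q‖ ≤ |HB β (E1 q)| * (2 / |q₀| ^ 2) := by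
  unfold A3
  rw [norm_div, Complex.norm_real, Real.norm_eq_abs, abs_mul, abs_mul, norm_pow]
  have h0 := abs_pos.2 hq
  have h1 : |q₀| ≤ ‖dn q₀ q‖ := den_re_im q₀ _
  have h2 := fermi_sub_abs_le β (q.1 * q.2.1) (q.2.2.1 * q.2.2.2)
  calc _ ≤ |(-2 : ℝ)| * |HB β (E1 q)| * 1 / |q₀| ^ 2 := by gcongr
    _ = _ := by norm_num; ring

lemma zeta3_tendsto (q₀ : ℝ) (hq : q₀ ≠ 0) : Tendsto (fun β => zeta3 q₀ β) atTop (𝓝 0) := by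
  simp only [zeta3_eq q₀ _ hq]
  have h := tendsto_integral_filter_of_dominated_convergence (μ := mu.prod nu) (l := atTop)
    (F := fun (β : ℝ) q => A3 q₀ β q) (f := fun _ => 0)
    (fun q => 1 / 2 * (2 / |q₀| ^ 2)) ?_ ?_ ?_ ?_
  · simpa using h
  · exact Eventually.of_forall fun β => (A3_cont q₀ β hq).aestronglyMeasurable
  · refine Eventually.of_forall fun β => Eventually.of_forall fun q => ?_
    refine (A3_norm q₀ β hq q).trans ?_
    have := HB_abs_le β (E1 q)
    gcongr
  · exact integrable_const _
  · refine Eventually.of_forall fun q => ?_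
    refine squeeze_zero_norm (fun β => A3_norm q₀ β hq q) ?_
    have := (HB_tendsto (E1 q)).abs.mul_const (2 / |q₀| ^ 2)
    rwa [abs_zero, zero_mul] at this

/-- **Vanishing of `ζ₂` and `ζ₃` at zero temperature.** For every fixed `q₀ ≠ 0`,
`ζ₂(β) → 0` and `ζ₃(β) → 0` as `β → ∞`. -/
theorem stmt_15 (q₀ : ℝ) (hq₀ : q₀ ≠ 0) :
    Filter.Tendsto (fun β : ℝ => zeta2 q₀ β) Filter.atTop (nhds 0) ∧
    Filter.Tendsto (fun β : ℝ => zeta3 q₀ β) Filter.atTop (nhds 0) :=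
  ⟨zeta2_tendsto q₀ hq₀, zeta3_tendsto q₀ hq₀⟩
end

section
/- Let β₀ ≥ 0, let F : [β₀, ∞) × [−1,1]⁴ → ℂ be a bounded measurable function, and let f : [−1,1]³ → ℂ be a measurable function such that for almost every (x, y, y') ∈ [−1,1]³ with y > y' and almost every u ∈ ℝ, F(β, x, y, x − u/(β(y − y')), y') → f(x, y, y') as β → ∞ (the expression being defined for all β large enough that x − u/(β(y − y')) ∈ [−1,1]). Set E₁ = (x − x')(y − y'). Then lim_{β→∞} ∫_{[−1,1]⁴} F(β, x, y, x', y') δ_β(E₁) (y − y') 1[y > y'] dx dy dx' dy' = ∫_{[−1,1]³} 1[y > y'] f(x, y, y') dx dy dy'. -/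
open MeasureTheory

lemma deltaB_one_eq (u : ℝ) : deltaB 1 u = Real.sigmoid u * (1 - Real.sigmoid u) := by
  unfold deltaB
  rw [Real.sigmoid_def, Real.cosh_eq, one_mul]
  have h1 : Real.exp (-u) = Real.exp (-(u/2)) * Real.exp (-(u/2)) := by
    rw [← Real.exp_add]; congr 1; ring
  have h2 : Real.exp (u/2) * Real.exp (-(u/2)) = 1 := by
    rw [← Real.exp_add]; simp
  rw [h1]
  set a := Real.exp (u/2)
  have hb : 0 < Real.exp (-(u/2)) := Real.exp_pos _
  set b := Real.exp (-(u/2))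
  have ha : a = b⁻¹ := eq_inv_of_mul_eq_one_left h2
  rw [ha]
  have : 0 < 1 + b * b := by positivity
  have : 0 < 1 + b ^ 2 := by positivity
  field_simp
  ring

lemma deltaB_one_deriv (u : ℝ) : HasDerivAt Real.sigmoid (deltaB 1 u) u := by
  rw [deltaB_one_eq]
  exact Real.hasDerivAt_sigmoid u

lemma deltaB_nonneg {β : ℝ} (hβ : 0 ≤ β) (u : ℝ) : 0 ≤ deltaB β u := by
  unfold deltaB; positivity

lemma deltaB_le {β : ℝ} (hβ : 0 ≤ β) (u : ℝ) : deltaB β u ≤ β := by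
  unfold deltaB
  apply div_le_self hβ
  nlinarith [Real.one_le_cosh (β * u / 2)]

lemma deltaB_measurable : Measurable (fun p : ℝ × ℝ => deltaB p.1 p.2) := by
  unfold deltaB; fun_prop

lemma deltaB_integrable : Integrable (deltaB 1) := by
  have hI : IntegrableOn (deltaB 1) (Set.Ioi (-1)) :=
    integrableOn_Ioi_deriv_of_nonneg' (fun x _ => deltaB_one_deriv x)
      (fun x _ => deltaB_nonneg zero_le_one x) Real.tendsto_sigmoid_atTop
  have hJ := hI.integrable_indicator measurableSet_Ioi
  have heven : ∀ x, deltaB 1 (-x) = deltaB 1 x := by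
    intro x
    unfold deltaB
    rw [show 1 * -x / 2 = -(1 * x / 2) by ring, Real.cosh_neg]
  have hm : Measurable (deltaB 1) :=
    deltaB_measurable.comp (measurable_const.prodMk measurable_id)
  refine (hJ.add hJ.comp_neg).mono' hm.aestronglyMeasurable
    (Filter.Eventually.of_forall fun x => ?_)
  have h0 := deltaB_nonneg zero_le_one x
  rw [Real.norm_of_nonneg h0]
  simp only [Pi.add_apply, Set.indicator, Set.mem_Ioi, heven]
  split_ifs <;> linarith

lemma deltaB_integral : ∫ u, deltaB 1 u = 1 := by
  rw [integral_of_hasDerivAt_of_tendsto deltaB_one_deriv deltaB_integrable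
    Real.tendsto_sigmoid_atBot Real.tendsto_sigmoid_atTop]
  simp

lemma interval_eq (g : ℝ → ℂ) :
    ∫ x in (-1 : ℝ)..1, g x = ∫ x in Set.Ioo (-1 : ℝ) 1, g x := by
  rw [intervalIntegral.integral_of_le (by norm_num), integral_Ioc_eq_integral_Ioo]

lemma triple {μ : Measure ℝ} [SFinite μ] (h : ℝ × ℝ × ℝ → ℂ)
    (hh : Integrable h (μ.prod (μ.prod μ))) :
    ∫ p, h p ∂(μ.prod (μ.prod μ)) = ∫ x, ∫ y, ∫ y', h (x, y, y') ∂μ ∂μ ∂μ := by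
  rw [integral_prod _ hh]
  apply integral_congr_ae
  filter_upwards [hh.prod_right_ae] with x hx
  rw [integral_prod _ hx]

lemma change_var (g : ℝ → ℂ) (x c β d : ℝ) (hd : 0 < d) (hβ : 0 < β) (hc : c = β * d) :
    ∫ x' in Set.Ioo (-1 : ℝ) 1, ((deltaB β ((x - x') * d) * d : ℝ) : ℂ) * g x' =
      ∫ u, if x - u / c ∈ Set.Ioo (-1 : ℝ) 1 then ((deltaB 1 u : ℝ) : ℂ) * g (x - u / c)
        else 0 := by
  have hc0 : 0 < c := by rw [hc]; positivity
  rw [← integral_indicator measurableSet_Ioo]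
  set k : ℝ → ℂ := (Set.Ioo (-1 : ℝ) 1).indicator
    (fun x' => ((deltaB β ((x - x') * d) * d : ℝ) : ℂ) * g x') with hk
  have e1 : ∫ x', k x' = ∫ v, k (x - v) := (integral_sub_left_eq_self k volume x).symm
  have e2 : ∫ u, k (x - u / c) = |c| • ∫ v, k (x - v) :=
    Measure.integral_comp_div (fun v => k (x - v)) c
  have e3 : ∫ x', k x' = c⁻¹ • ∫ u, k (x - u / c) := by
    rw [e1, e2, abs_of_pos hc0, smul_smul, inv_mul_cancel₀ hc0.ne', one_smul]
  rw [e3, ← integral_smul]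
  congr 1
  ext u
  by_cases hu : x - u / c ∈ Set.Ioo (-1 : ℝ) 1
  · rw [if_pos hu, hk, Set.indicator_of_mem hu, Complex.real_smul, ← mul_assoc,
      ← Complex.ofReal_mul]
    congr 2
    have : β * ((x - (x - u / c)) * d) / 2 = 1 * u / 2 := by
      rw [hc]; field_simp; ring
    unfold deltaB
    rw [this, hc]
    have := (Real.cosh_pos (1 * u / 2)).ne'
    field_simp
  · rw [if_neg hu, hk, Set.indicator_of_notMem hu, smul_zero]

/-- **Approximate-delta limit lemma.** Let `β₀ ≥ 0`, let `F` be bounded and measurable on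
`[β₀,∞) × [-1,1]⁴` and suppose that for almost every `(x, y, y', u)` with
`(x, y, y') ∈ [-1,1]³`, `y > y'`, one has
`F(β, x, y, x - u/(β(y-y')), y') → f(x, y, y')` as `β → ∞`. Then with
`E₁ = (x-x')(y-y')`,
`∫_{[-1,1]⁴} F(β, x, y, x', y') δ_β(E₁) (y-y') 1[y > y'] → ∫_{[-1,1]³} 1[y > y'] f`. -/
theorem stmt_17 (β₀ : ℝ) (hβ₀ : 0 ≤ β₀)
    (F : ℝ → ℝ → ℝ → ℝ → ℝ → ℂ)
    (hFmeas : Measurable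
      (fun p : ℝ × ℝ × ℝ × ℝ × ℝ => F p.1 p.2.1 p.2.2.1 p.2.2.2.1 p.2.2.2.2))
    (hFbdd : ∃ Cb : ℝ, ∀ β : ℝ, β₀ ≤ β → ∀ x ∈ Set.Icc (-1 : ℝ) 1,
      ∀ y ∈ Set.Icc (-1 : ℝ) 1, ∀ x' ∈ Set.Icc (-1 : ℝ) 1, ∀ y' ∈ Set.Icc (-1 : ℝ) 1,
        ‖F β x y x' y'‖ ≤ Cb)
    (f : ℝ → ℝ → ℝ → ℂ)
    (hfmeas : Measurable (fun p : ℝ × ℝ × ℝ => f p.1 p.2.1 p.2.2))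
    (hconv : ∀ᵐ p ∂(volume : Measure ((ℝ × ℝ × ℝ) × ℝ)),
      (p.1.1 ∈ Set.Icc (-1 : ℝ) 1 ∧ p.1.2.1 ∈ Set.Icc (-1 : ℝ) 1 ∧
          p.1.2.2 ∈ Set.Icc (-1 : ℝ) 1 ∧ p.1.2.2 < p.1.2.1) →
        Filter.Tendsto
          (fun β : ℝ => F β p.1.1 p.1.2.1 (p.1.1 - p.2 / (β * (p.1.2.1 - p.1.2.2))) p.1.2.2)
          Filter.atTop (nhds (f p.1.1 p.1.2.1 p.1.2.2))) :
    Filter.Tendsto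
      (fun β : ℝ =>
        ∫ x in (-1 : ℝ)..1, ∫ y in (-1 : ℝ)..1, ∫ x' in (-1 : ℝ)..1, ∫ y' in (-1 : ℝ)..1,
          (if y' < y then
            ((deltaB β ((x - x') * (y - y')) * (y - y') : ℝ) : ℂ) * F β x y x' y'
          else 0))
      Filter.atTop
      (nhds (∫ x in (-1 : ℝ)..1, ∫ y in (-1 : ℝ)..1, ∫ y' in (-1 : ℝ)..1,
        (if y' < y then f x y y' else 0))) := by
  classical
  obtain ⟨C, hC⟩ := hFbdd
  simp only [interval_eq]
  set μ : Measure ℝ := volume.restrict (Set.Ioo (-1 : ℝ) 1) with hμ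
  have hC0 : 0 ≤ C := (norm_nonneg _).trans
    (hC β₀ le_rfl 0 (by norm_num) 0 (by norm_num) 0 (by norm_num) 0 (by norm_num))
  have hIoo : ∀ t : ℝ, t ∈ Set.Ioo (-1 : ℝ) 1 → t ∈ Set.Icc (-1 : ℝ) 1 :=
    fun t ht => Set.Ioo_subset_Icc_self ht
  let G : ℝ → (ℝ × ℝ × ℝ) × ℝ → ℂ := fun β p =>
    if p.1.2.2 < p.1.2.1 then
      (if p.1.1 - p.2 / (β * (p.1.2.1 - p.1.2.2)) ∈ Set.Ioo (-1 : ℝ) 1 then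
        ((deltaB 1 p.2 : ℝ) : ℂ) *
          F β p.1.1 p.1.2.1 (p.1.1 - p.2 / (β * (p.1.2.1 - p.1.2.2))) p.1.2.2
      else 0) else 0
  let h : ℝ × ℝ × ℝ → ℂ := fun p => if p.2.2 < p.2.1 then f p.1 p.2.1 p.2.2 else 0
  let ν := (μ.prod (μ.prod μ)).prod (volume : Measure ℝ)
  have hνdef : ν = volume.restrict ((Set.Ioo (-1 : ℝ) 1 ×ˢ Set.Ioo (-1 : ℝ) 1 ×ˢ
      Set.Ioo (-1 : ℝ) 1) ×ˢ (Set.univ : Set ℝ)) := by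
    simp only [ν, hμ, Measure.prod_restrict, Measure.volume_eq_prod]
    conv_rhs => rw [← Measure.prod_restrict, Measure.restrict_univ]
  have hmem : ∀ᵐ p ∂ν, p.1.1 ∈ Set.Ioo (-1 : ℝ) 1 ∧ p.1.2.1 ∈ Set.Ioo (-1 : ℝ) 1 ∧
      p.1.2.2 ∈ Set.Ioo (-1 : ℝ) 1 := by
    rw [hνdef]
    filter_upwards [ae_restrict_mem ((measurableSet_Ioo.prod (measurableSet_Ioo.prod
      measurableSet_Ioo)).prod MeasurableSet.univ)] with p hp
    exact ⟨hp.1.1, hp.1.2.1, hp.1.2.2⟩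
  have hconv' := ae_mono (Measure.restrict_le_self (μ := volume)
    (s := ((Set.Ioo (-1 : ℝ) 1 ×ˢ Set.Ioo (-1 : ℝ) 1 ×ˢ
      Set.Ioo (-1 : ℝ) 1) ×ˢ (Set.univ : Set ℝ)))) hconv
  rw [← hνdef] at hconv'
  have hδm : Measurable (deltaB 1) :=
    deltaB_measurable.comp (measurable_const.prodMk measurable_id)
  have hGm : ∀ β, Measurable (G β) := by
    intro β
    have hlt : MeasurableSet {p : (ℝ × ℝ × ℝ) × ℝ | p.1.2.2 < p.1.2.1} :=
      measurableSet_lt (by fun_prop) (by fun_prop)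
    have hx : Measurable (fun p : (ℝ × ℝ × ℝ) × ℝ =>
      p.1.1 - p.2 / (β * (p.1.2.1 - p.1.2.2))) := by fun_prop
    refine Measurable.ite hlt (Measurable.ite (hx measurableSet_Ioo) ?_ measurable_const)
      measurable_const
    refine Measurable.mul (Complex.measurable_ofReal.comp (hδm.comp measurable_snd)) ?_
    exact hFmeas.comp (measurable_const.prodMk ((by fun_prop : Measurable
      (fun p : (ℝ × ℝ × ℝ) × ℝ => p.1.1)).prodMk ((by fun_prop : Measurable
      (fun p : (ℝ × ℝ × ℝ) × ℝ => p.1.2.1)).prodMk (hx.prodMk (by fun_prop : Measurable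
      (fun p : (ℝ × ℝ × ℝ) × ℝ => p.1.2.2))))))
  have hGb : ∀ β, β₀ ≤ β → ∀ᵐ p ∂ν, ‖G β p‖ ≤ C * deltaB 1 p.2 := by
    intro β hβ
    filter_upwards [hmem] with p hp
    have hd := deltaB_nonneg zero_le_one p.2
    simp only [G]
    split_ifs with h1 h2
    · rw [norm_mul, Complex.norm_real, Real.norm_of_nonneg hd, mul_comm]
      exact mul_le_mul_of_nonneg_right (hC β hβ _ (hIoo _ hp.1) _ (hIoo _ hp.2.1) _ (hIoo _ h2)
        _ (hIoo _ hp.2.2)) hd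
    · simpa using mul_nonneg hC0 hd
    · simpa using mul_nonneg hC0 hd
  have hbint : Integrable (fun p : (ℝ × ℝ × ℝ) × ℝ => C * deltaB 1 p.2) ν := by
    have : Integrable (fun p : (ℝ × ℝ × ℝ) × ℝ => (fun _ => C) p.1 * deltaB 1 p.2) ν :=
      Integrable.mul_prod (integrable_const C) deltaB_integrable
    exact this
  have hGi : ∀ β, β₀ ≤ β → Integrable (G β) ν := fun β hβ =>
    hbint.mono' (hGm β).aestronglyMeasurable (hGb β hβ)
  have hlim : ∀ᵐ p ∂ν, Filter.Tendsto (fun β => G β p) Filter.atTop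
      (nhds (h p.1 * ((deltaB 1 p.2 : ℝ) : ℂ))) := by
    filter_upwards [hmem, hconv'] with p hp hc
    simp only [G, h]
    split_ifs with h1
    · have hc' := hc ⟨hIoo _ hp.1, hIoo _ hp.2.1, hIoo _ hp.2.2, h1⟩
      have hx : Filter.Tendsto (fun β : ℝ => p.1.1 - p.2 / (β * (p.1.2.1 - p.1.2.2)))
          Filter.atTop (nhds (p.1.1 - 0)) := by
        refine tendsto_const_nhds.sub (Filter.Tendsto.div_atTop tendsto_const_nhds ?_)
        exact Filter.Tendsto.atTop_mul_const (sub_pos.2 h1) Filter.tendsto_id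
      rw [sub_zero] at hx
      have hev := hx.eventually (isOpen_Ioo.mem_nhds hp.1)
      rw [mul_comm]
      refine (hc'.const_mul _).congr' ?_
      filter_upwards [hev] with β hβ
      exact (if_pos hβ).symm
    · simp
  have hDCT : Filter.Tendsto (fun β => ∫ p, G β p ∂ν) Filter.atTop
      (nhds (∫ p, h p.1 * ((deltaB 1 p.2 : ℝ) : ℂ) ∂ν)) := by
    refine tendsto_integral_filter_of_dominated_convergence _ ?_ ?_ hbint hlim
    · exact Filter.Eventually.of_forall fun β => (hGm β).aestronglyMeasurable
    · filter_upwards [Filter.eventually_ge_atTop β₀] with β hβ using hGb β hβ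
  have hhm : Measurable h :=
    Measurable.ite (measurableSet_lt (by fun_prop) (by fun_prop)) hfmeas measurable_const
  have hLi : Integrable (fun p : (ℝ × ℝ × ℝ) × ℝ => h p.1 * ((deltaB 1 p.2 : ℝ) : ℂ)) ν := by
    refine hbint.mono' ?_ ?_
    · exact ((hhm.comp measurable_fst).mul
        (Complex.measurable_ofReal.comp (hδm.comp measurable_snd))).aestronglyMeasurable
    · have hall : ∀ᵐ p ∂ν, ∀ n : ℕ, ‖G (β₀ + n) p‖ ≤ C * deltaB 1 p.2 :=
        ae_all_iff.2 fun n => hGb _ (by simp)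
      filter_upwards [hall, hlim] with p hp hl
      have ht : Filter.Tendsto (fun n : ℕ => β₀ + (n : ℝ)) Filter.atTop Filter.atTop :=
        Filter.tendsto_atTop_add_const_left _ _ tendsto_natCast_atTop_atTop
      exact le_of_tendsto (hl.comp ht).norm (Filter.Eventually.of_forall hp)
  have hone : ∫ u, ((deltaB 1 u : ℝ) : ℂ) = 1 := by
    rw [integral_complex_ofReal, deltaB_integral, Complex.ofReal_one]
  have hhi : Integrable h (μ.prod (μ.prod μ)) := by
    have := hLi.integral_prod_left
    simpa only [integral_const_mul, hone, mul_one] using this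
  have hR : ∫ p, h p.1 * ((deltaB 1 p.2 : ℝ) : ℂ) ∂ν =
      ∫ x, ∫ y, ∫ y', (if y' < y then f x y y' else 0) ∂μ ∂μ ∂μ := by
    rw [integral_prod _ hLi]
    simp only [integral_const_mul, hone, mul_one]
    exact triple h hhi
  rw [← hR]
  refine hDCT.congr' ?_
  filter_upwards [Filter.eventually_ge_atTop β₀, Filter.eventually_gt_atTop 0] with β hβ hβ0
  rw [integral_prod _ (hGi β hβ), triple _ (hGi β hβ).integral_prod_left]
  refine setIntegral_congr_fun measurableSet_Ioo fun x hx => ?_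
  refine setIntegral_congr_fun measurableSet_Ioo fun y hy => ?_
  have hswap : ∫ x', ∫ y', (if y' < y then
      ((deltaB β ((x - x') * (y - y')) * (y - y') : ℝ) : ℂ) * F β x y x' y' else 0) ∂μ ∂μ =
      ∫ y', ∫ x', (if y' < y then
      ((deltaB β ((x - x') * (y - y')) * (y - y') : ℝ) : ℂ) * F β x y x' y' else 0) ∂μ ∂μ := by
    refine integral_integral_swap ?_
    refine (integrable_const (β * 2 * C)).mono' ?_ ?_
    · refine Measurable.aestronglyMeasurable ?_
      refine Measurable.ite (measurableSet_lt (by fun_prop) (by fun_prop)) ?_ measurable_const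
      refine Measurable.mul (Complex.measurable_ofReal.comp (Measurable.mul ?_ (by fun_prop))) ?_
      · exact deltaB_measurable.comp (measurable_const.prodMk (by fun_prop))
      · exact hFmeas.comp (measurable_const.prodMk (measurable_const.prodMk
          (measurable_const.prodMk (measurable_fst.prodMk measurable_snd))))
    · have : ∀ᵐ q ∂(μ.prod μ), q ∈ Set.Ioo (-1 : ℝ) 1 ×ˢ Set.Ioo (-1 : ℝ) 1 := by
        rw [hμ, Measure.prod_restrict]
        exact ae_restrict_mem (measurableSet_Ioo.prod measurableSet_Ioo)
      filter_upwards [this] with q hq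
      simp only [Function.uncurry]
      split_ifs with h1
      · rw [norm_mul, Complex.norm_real, Real.norm_of_nonneg
          (mul_nonneg (deltaB_nonneg hβ0.le _) (sub_pos.2 h1).le)]
        refine mul_le_mul (mul_le_mul (deltaB_le hβ0.le _) ?_ (sub_pos.2 h1).le hβ0.le)
          (hC β hβ _ (hIoo _ hx) _ (hIoo _ hy) _ (hIoo _ hq.1) _ (hIoo _ hq.2))
          (norm_nonneg _) (by positivity)
        linarith [hy.2, hq.2.1]
      · simp only [norm_zero]; positivity
  refine Eq.trans ?_ hswap.symm
  refine integral_congr_ae (Filter.Eventually.of_forall fun y' => ?_)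
  simp only [G]
  by_cases h1 : y' < y
  · simp only [if_pos h1]
    exact (change_var (fun x' => F β x y x' y') x (β * (y - y')) β (y - y')
      (sub_pos.2 h1) hβ0 rfl).symm
  · simp only [if_neg h1, integral_zero]
end

section
/- Let K = ∫₀^∞ (log(2v))/cosh²(v) dv and K' = ∫₀^∞ (log(2v))²/cosh²(v) dv. Then there exist constants C and β₀ > 0 such that for all β ≥ β₀, the particle–particle bubble B_pp(β) = ∫_{[−1,1]²} tanh(β x y / 2)/(2 x y) dx dy satisfies |B_pp(β) − (log β)² + 2 K log β − K'| ≤ C e^{−β}. -/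
open MeasureTheory

/-- The particle–particle bubble
`B_pp(β) = ∫_{[-1,1]²} tanh(βxy/2)/(2xy) dx dy`, the integrand being extended
continuously by the value `β/4` on the set where `xy = 0`. -/
noncomputable def Bpp (β : ℝ) : ℝ :=
  ∫ x in (-1 : ℝ)..1, ∫ y in (-1 : ℝ)..1,
    (if x * y = 0 then β / 4 else Real.tanh (β * x * y / 2) / (2 * x * y))

section Helpers

open Set Filter Topology

lemma aux_hasDerivAt_tanh (x : ℝ) : HasDerivAt Real.tanh (1 / Real.cosh x ^ 2) x := by
  have h := (Real.hasDerivAt_sinh x).div (Real.hasDerivAt_cosh x) (Real.cosh_pos x).ne'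
  have e : Real.tanh = Real.sinh / Real.cosh := by
    funext y; simp [Real.tanh_eq_sinh_div_cosh]
  rw [e]
  refine h.congr_deriv ?_
  rw [← Real.cosh_sq_sub_sinh_sq x]; ring

lemma aux_sech_le (v : ℝ) : 1 / Real.cosh v ^ 2 ≤ 4 * Real.exp (-(2 * v)) := by
  have h1 : Real.exp v / 2 ≤ Real.cosh v := by
    rw [Real.cosh_eq]; have := Real.exp_pos (-v); linarith
  have h0 := Real.exp_pos v
  have h2 : (Real.exp v / 2) ^ 2 ≤ Real.cosh v ^ 2 := by gcongr
  have h3 : 1 / Real.cosh v ^ 2 ≤ 1 / (Real.exp v / 2) ^ 2 := by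
    apply one_div_le_one_div_of_le _ h2; positivity
  refine h3.trans (le_of_eq ?_)
  rw [Real.exp_neg, show 2 * v = v + v by ring, Real.exp_add]
  field_simp
  norm_num

lemma aux_sech_le' {v : ℝ} (hv : 0 ≤ v) : 1 / Real.cosh v ^ 2 ≤ 4 * Real.exp (-v) := by
  refine (aux_sech_le v).trans ?_
  gcongr
  linarith

lemma aux_tendsto_tanh : Tendsto Real.tanh atTop (𝓝 1) := by
  have h1 : Tendsto (fun x : ℝ => 1 - Real.exp (-x)) atTop (𝓝 1) := by
    have := (tendsto_const_nhds (x := (1:ℝ))).sub (Real.tendsto_exp_neg_atTop_nhds_zero)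
    simpa using this
  refine tendsto_of_tendsto_of_tendsto_of_le_of_le h1 tendsto_const_nhds ?_ ?_
  · intro x
    have hc := Real.one_le_cosh x
    have hc0 := Real.cosh_pos x
    have : 1 - Real.tanh x = Real.exp (-x) / Real.cosh x := by
      rw [Real.tanh_eq_sinh_div_cosh, ← Real.cosh_sub_sinh]; field_simp
    have h2 : Real.exp (-x) / Real.cosh x ≤ Real.exp (-x) := div_le_self (Real.exp_pos _).le hc
    simp only
    linarith
  · intro x; exact (Real.tanh_lt_one x).le

lemma aux_cont_sech : Continuous (fun v : ℝ => 1 / Real.cosh v ^ 2) :=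
  continuous_const.div (Real.continuous_cosh.pow 2) (fun x => (pow_pos (Real.cosh_pos x) 2).ne')

lemma aux_int_sech : IntegrableOn (fun v : ℝ => 1 / Real.cosh v ^ 2) (Ioi 0) := by
  have h : IntegrableOn (fun v : ℝ => 4 * Real.exp (-v)) (Ioi 0) :=
    (integrableOn_exp_neg_Ioi 0).const_mul 4
  refine Integrable.mono' h aux_cont_sech.aestronglyMeasurable ?_
  refine (ae_restrict_iff' measurableSet_Ioi).2 (Eventually.of_forall fun v hv => ?_)
  rw [Real.norm_of_nonneg (by positivity)]
  exact aux_sech_le' (le_of_lt hv)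

lemma aux_integral_sech : ∫ v in Ioi (0:ℝ), 1 / Real.cosh v ^ 2 = 1 := by
  rw [integral_Ioi_of_hasDerivAt_of_tendsto' (fun x _ => aux_hasDerivAt_tanh x) aux_int_sech
    aux_tendsto_tanh]
  simp

lemma aux_log_sq {w : ℝ} (hw : 0 < w) :
    Real.log w ^ 2 ≤ 16 * (w ^ (1/2 : ℝ) + w ^ (-(1/2) : ℝ)) := by
  have h1 := Real.log_le_rpow_div hw.le (show (0:ℝ) < 1/4 by norm_num)
  have h2 := Real.log_le_rpow_div (inv_pos.2 hw).le (show (0:ℝ) < 1/4 by norm_num)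
  rw [Real.log_inv, Real.inv_rpow hw.le, ← Real.rpow_neg hw.le] at h2
  have p1 : w ^ (1/2 : ℝ) = (w ^ (1/4:ℝ)) ^ 2 := by
    rw [← Real.rpow_natCast, ← Real.rpow_mul hw.le]; norm_num
  have p2 : w ^ (-(1/2) : ℝ) = (w ^ (-(1/4):ℝ)) ^ 2 := by
    rw [← Real.rpow_natCast, ← Real.rpow_mul hw.le]; norm_num
  rw [p1, p2]
  have q1 := Real.rpow_pos_of_pos hw (1/4)
  have q2 := Real.rpow_pos_of_pos hw (-(1/4))
  rcases le_total 0 (Real.log w) with h | h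
  · have : Real.log w ^ 2 ≤ (w ^ (1/4:ℝ) / (1/4)) ^ 2 := by gcongr
    nlinarith [sq_nonneg (w ^ (-(1/4):ℝ))]
  · have : (-Real.log w) ^ 2 ≤ (w ^ (-(1/4):ℝ) / (1/4)) ^ 2 := by
      apply pow_le_pow_left₀ (by linarith) h2
    nlinarith [sq_nonneg (w ^ ((1/4):ℝ))]

lemma aux_int_log_sq :
    IntegrableOn (fun v : ℝ => Real.log (2 * v) ^ 2 / Real.cosh v ^ 2) (Ioi 0) := by
  have g1 := Real.GammaIntegral_convergent (s := 3/2) (by norm_num)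
  have g2 := Real.GammaIntegral_convergent (s := 1/2) (by norm_num)
  have g := ((g1.const_mul ((2:ℝ) ^ (1/2:ℝ))).add (g2.const_mul ((2:ℝ) ^ (-(1/2):ℝ)))).const_mul 64
  refine Integrable.mono' g ?_ ?_
  · apply Measurable.aestronglyMeasurable
    exact ((Real.measurable_log.comp (measurable_const.mul measurable_id)).pow_const 2).div
      (Real.continuous_cosh.measurable.pow_const 2)
  refine (ae_restrict_iff' measurableSet_Ioi).2 (Eventually.of_forall fun v hv => ?_)
  have hv : 0 < v := hv
  rw [Real.norm_of_nonneg (by positivity)]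
  have a := aux_log_sq (show 0 < 2 * v by positivity)
  have b := aux_sech_le' hv.le
  rw [Real.mul_rpow (by norm_num) hv.le, Real.mul_rpow (by norm_num) hv.le] at a
  have := mul_le_mul a b (by positivity) (by positivity)
  rw [mul_one_div] at this
  refine this.trans (le_of_eq ?_)
  simp only [Pi.add_apply]
  rw [show (3/2 - 1 : ℝ) = 1/2 by norm_num, show (1/2 - 1 : ℝ) = -(1/2) by norm_num]
  ring

lemma aux_int_log :
    IntegrableOn (fun v : ℝ => Real.log (2 * v) / Real.cosh v ^ 2) (Ioi 0) := by
  refine Integrable.mono' (aux_int_sech.add aux_int_log_sq) ?_ ?_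
  · apply Measurable.aestronglyMeasurable
    exact ((Real.measurable_log.comp (measurable_const.mul measurable_id))).div
      (Real.continuous_cosh.measurable.pow_const 2)
  refine Eventually.of_forall fun v => ?_
  simp only [Pi.add_apply]
  rw [norm_div, Real.norm_of_nonneg (show 0 ≤ Real.cosh v ^ 2 by positivity), ← add_div]
  gcongr
  rw [Real.norm_eq_abs, abs_le]
  constructor <;> nlinarith [sq_nonneg (Real.log (2 * v) + 1), sq_nonneg (Real.log (2 * v) - 1)]

lemma aux_int_main (L : ℝ) :
    IntegrableOn (fun v : ℝ => (L - Real.log (2 * v)) ^ 2 / Real.cosh v ^ 2) (Ioi 0) ∧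
    ∫ v in Ioi (0:ℝ), (L - Real.log (2 * v)) ^ 2 / Real.cosh v ^ 2 =
      L ^ 2 - 2 * (∫ v in Ioi (0:ℝ), Real.log (2 * v) / Real.cosh v ^ 2) * L +
        ∫ v in Ioi (0:ℝ), Real.log (2 * v) ^ 2 / Real.cosh v ^ 2 := by
  have e : (fun v : ℝ => (L - Real.log (2 * v)) ^ 2 / Real.cosh v ^ 2) =
      fun v => (L ^ 2 * (1 / Real.cosh v ^ 2) - 2 * L * (Real.log (2 * v) / Real.cosh v ^ 2)) +
        Real.log (2 * v) ^ 2 / Real.cosh v ^ 2 := by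
    funext v; ring
  have i1 := aux_int_sech.const_mul (L ^ 2)
  have i2 := aux_int_log.const_mul (2 * L)
  rw [e]
  refine ⟨(i1.sub i2).add aux_int_log_sq, ?_⟩
  rw [integral_add (by exact i1.sub i2) aux_int_log_sq, integral_sub i1 i2, integral_const_mul,
    integral_const_mul, aux_integral_sech]
  ring

lemma aux_tail {β : ℝ} (hβ : 1 ≤ β) :
    |∫ v in Ioi (β / 2), (Real.log β - Real.log (2 * v)) ^ 2 / Real.cosh v ^ 2| ≤
      32 * Real.exp (-β) := by
  rw [abs_of_nonneg (integral_nonneg fun v => by positivity)]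
  have hi : IntegrableOn (fun v : ℝ => (32 * Real.exp (-(β/2))) * Real.exp (-v)) (Ioi (β/2)) :=
    (integrableOn_exp_neg_Ioi _).const_mul _
  have hI : ∫ v in Ioi (β/2), (32 * Real.exp (-(β/2))) * Real.exp (-v) = 32 * Real.exp (-β) := by
    rw [integral_const_mul, integral_exp_neg_Ioi, mul_assoc, ← Real.exp_add]
    congr 2; ring
  rw [← hI]
  refine setIntegral_mono_on ((aux_int_main _).1.mono_set (Ioi_subset_Ioi (by linarith))) hi
    measurableSet_Ioi fun v hv => ?_
  have hv : β / 2 < v := hv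
  have hb : 0 < β := by linarith
  have hv0 : 0 < v := by linarith
  have l1 : Real.log (2 * v) - Real.log β = Real.log (2 * v / β) :=
    (Real.log_div (by positivity) hb.ne').symm
  have l2 : 0 ≤ Real.log (2 * v / β) := Real.log_nonneg (by rw [le_div_iff₀ hb]; linarith)
  have l3 : Real.log (2 * v / β) ≤ 2 * (v - β / 2) := by
    refine (Real.log_le_sub_one_of_pos (by positivity)).trans ?_
    rw [show 2 * v / β - 1 = (2 * v - β) / β by field_simp]
    rw [div_le_iff₀ hb]; nlinarith
  have s2 : (v - β / 2) ^ 2 ≤ 2 * Real.exp (v - β / 2) := by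
    have := Real.quadratic_le_exp_of_nonneg (show 0 ≤ v - β / 2 by linarith)
    linarith
  have m : (Real.log β - Real.log (2 * v)) ^ 2 ≤ 8 * Real.exp (v - β / 2) := by
    have : (Real.log β - Real.log (2 * v)) ^ 2 = Real.log (2 * v / β) ^ 2 := by rw [← l1]; ring
    rw [this]
    have := pow_le_pow_left₀ l2 l3 2
    linarith
  have := mul_le_mul m (aux_sech_le v) (by positivity) (by positivity)
  rw [mul_one_div] at this
  refine this.trans (le_of_eq ?_)
  have : Real.exp (v - β/2) * Real.exp (-(2 * v)) = Real.exp (-(β/2)) * Real.exp (-v) := by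
    rw [← Real.exp_add, ← Real.exp_add]; congr 1; ring
  linear_combination 32 * this

lemma aux_cont_log_sq : ContinuousOn (fun x : ℝ => x * Real.log x ^ 2) (Ici 0) := by
  have h : Continuous (fun x : ℝ => 4 * (√x * Real.log √x) ^ 2) :=
    continuous_const.mul ((Real.continuous_mul_log.comp Real.continuous_sqrt).pow 2)
  refine h.continuousOn.congr fun x hx => ?_
  simp only
  rw [Real.log_sqrt hx, mul_pow, Real.sq_sqrt hx]; ring

lemma aux_cont_dslope {f f' : ℝ → ℝ} (h : ∀ x, HasDerivAt f (f' x) x) :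
    Continuous (dslope f 0) := by
  rw [← continuousOn_univ, continuousOn_dslope univ_mem]
  exact ⟨fun x _ => (h x).continuousAt.continuousWithinAt, (h 0).differentiableAt⟩

lemma aux_even {f : ℝ → ℝ} (hf : Continuous f) (he : ∀ x, f (-x) = f x) :
    ∫ x in (-1:ℝ)..1, f x = 2 * ∫ x in (0:ℝ)..1, f x := by
  rw [← intervalIntegral.integral_add_adjacent_intervals (hf.intervalIntegrable (-1) 0)
    (hf.intervalIntegrable 0 1)]
  have : ∫ x in (-1:ℝ)..0, f x = ∫ x in (0:ℝ)..1, f x := by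
    have := intervalIntegral.integral_comp_neg (a := 0) (b := 1) f
    simp only [he, neg_zero] at this
    exact this.symm
  rw [this]; ring

lemma aux_Bpp {β : ℝ} (hβ : 0 < β) :
    Bpp β = ∫ v in (0:ℝ)..(β / 2), (Real.log β - Real.log (2 * v)) ^ 2 / Real.cosh v ^ 2 := by
  set T : ℝ → ℝ := fun x => Real.tanh (β / 2 * x) with hT
  set T' : ℝ → ℝ := fun x => 1 / Real.cosh (β / 2 * x) ^ 2 * (β / 2) with hT'
  have dT : ∀ x, HasDerivAt T (T' x) x := fun x => by
    have := (aux_hasDerivAt_tanh (β / 2 * x)).comp x ((hasDerivAt_id x).const_mul (β / 2))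
    simpa [hT, hT', Function.comp_def] using this
  set h := dslope T 0 with hh
  have ch : Continuous h := aux_cont_dslope dT
  have T0 : T 0 = 0 := by simp [hT]
  have h0 : h 0 = β / 2 := by
    rw [hh, dslope_same, (dT 0).deriv]; simp [hT']
  have hne : ∀ x, x ≠ 0 → h x = T x / x := fun x hx => by
    rw [hh, dslope_of_ne _ hx, slope_def_field, T0]; simp
  have Th : ∀ x, T x = x * h x := fun x => by
    rcases eq_or_ne x 0 with rfl | hx
    · simp [T0]
    · rw [hne x hx]; field_simp
  have he : ∀ x, h (-x) = h x := fun x => by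
    rcases eq_or_ne x 0 with rfl | hx
    · simp
    · rw [hne x hx, hne _ (neg_ne_zero.2 hx)]; simp [hT, Real.tanh_neg, neg_div_neg_eq]
  set F : ℝ → ℝ := fun x => ∫ u in (0:ℝ)..x, h u with hF
  have dF : ∀ x, HasDerivAt F (h x) x := fun x =>
    intervalIntegral.integral_hasDerivAt_right (ch.intervalIntegrable _ _)
      (ch.stronglyMeasurableAtFilter _ _) ch.continuousAt
  set A := dslope F 0 with hA
  have cA : Continuous A := aux_cont_dslope dF
  have F0 : F 0 = 0 := by simp [hF]
  have A0 : A 0 = β / 2 := by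
    rw [hA, dslope_same, (dF 0).deriv, h0]
  have Ane : ∀ x, x ≠ 0 → A x = F x / x := fun x hx => by
    rw [hA, dslope_of_ne _ hx, slope_def_field, F0]; simp
  have FA : ∀ x, F x = x * A x := fun x => by
    rcases eq_or_ne x 0 with rfl | hx
    · simp [F0]
    · rw [Ane x hx]; field_simp
  have Aint : ∀ x, A x = ∫ y in (0:ℝ)..1, h (x * y) := fun x => by
    rcases eq_or_ne x 0 with rfl | hx
    · simp [A0, h0]
    · rw [Ane x hx, intervalIntegral.integral_comp_mul_left _ hx]
      simp [hF, div_eq_inv_mul]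
  have Ae : ∀ x, A (-x) = A x := fun x => by
    rw [Aint, Aint]; simp only [neg_mul, he]
  have inner : ∀ x, (∫ y in (-1 : ℝ)..1,
      (if x * y = 0 then β / 4 else Real.tanh (β * x * y / 2) / (2 * x * y))) = A x := fun x => by
    have e : (fun y : ℝ => (if x * y = 0 then β / 4
        else Real.tanh (β * x * y / 2) / (2 * x * y))) = fun y => (1/2) * h (x * y) := by
      funext y
      split_ifs with hxy
      · rw [hxy, h0]; ring
      · rw [hne _ hxy, hT]
        simp only
        rw [show β * x * y / 2 = β / 2 * (x * y) by ring, mul_assoc 2 x y]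
        field_simp
    rw [e, intervalIntegral.integral_const_mul, aux_even (f := fun y => h (x * y)) (by fun_prop)
      (fun y => by rw [mul_neg, he]), Aint]
    ring
  have B1 : Bpp β = 2 * ∫ x in (0:ℝ)..1, A x := by
    rw [Bpp]; simp only [inner]
    exact aux_even cA Ae
  set f : ℝ → ℝ := fun v => (Real.log β - Real.log (2 * v)) ^ 2 / Real.cosh v ^ 2 with hf
  have fi : IntervalIntegrable f volume 0 (β / 2) := by
    rw [intervalIntegrable_iff_integrableOn_Ioc_of_le (by positivity)]
    exact (aux_int_main _).1.mono_set Ioc_subset_Ioi_self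
  have fi2 : IntervalIntegrable (fun x => (β / 2) * f (β / 2 * x)) volume 0 1 := by
    have := (fi.comp_mul_left (c := β / 2)).const_mul (β/2)
    simpa [hβ.ne'] using this
  have sub : ∫ x in (0:ℝ)..1, (β / 2) * f (β / 2 * x) = ∫ v in (0:ℝ)..(β / 2), f v := by
    rw [intervalIntegral.integral_const_mul,
      intervalIntegral.integral_comp_mul_left f (by positivity)]
    simp; field_simp
  set G : ℝ → ℝ := fun x => 2 * (F x * Real.log x) - T x * Real.log x ^ 2 with hG
  have cG : ContinuousOn G (Icc 0 1) := by
    have c1 : ContinuousOn (fun x => 2 * (A x * (x * Real.log x)) - h x * (x * Real.log x ^ 2))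
        (Icc 0 1) :=
      (continuous_const.mul (cA.mul Real.continuous_mul_log)).continuousOn.sub
        (ch.continuousOn.mul (aux_cont_log_sq.mono Icc_subset_Ici_self))
    refine c1.congr fun x _ => ?_
    simp only [hG]
    rw [FA, Th]; ring
  have dG : ∀ x ∈ Ioo (0:ℝ) 1, HasDerivAt G (2 * A x - (β / 2) * f (β / 2 * x)) x := by
    intro x hx
    have hx0 : x ≠ 0 := hx.1.ne'
    have dl := Real.hasDerivAt_log hx0
    have d := (((dF x).mul dl).const_mul 2).sub ((dT x).mul (dl.pow 2))
    refine HasDerivAt.congr_deriv d ?_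
    have lf : Real.log β - Real.log (2 * (β / 2 * x)) = - Real.log x := by
      rw [show 2 * (β / 2 * x) = β * x by ring, Real.log_mul hβ.ne' hx0]; ring
    simp only [hf, hT', lf]
    rw [FA, Th]
    simp
    field_simp
    ring
  have key := intervalIntegral.integral_eq_sub_of_hasDerivAt_of_le (zero_le_one) cG dG
    (((cA.intervalIntegrable 0 1).const_mul 2).sub fi2)
  rw [intervalIntegral.integral_sub ((cA.intervalIntegrable 0 1).const_mul 2) fi2, sub,
    intervalIntegral.integral_const_mul, ← B1] at key
  have G1 : G 1 = 0 := by simp [hG]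
  have G0 : G 0 = 0 := by simp [hG]
  rw [G1, G0] at key
  linarith

end Helpers

/-- **Asymptotics of the particle–particle bubble.** With
`K = ∫₀^∞ log(2v)/cosh²(v) dv` and `K' = ∫₀^∞ (log(2v))²/cosh²(v) dv`, there are
constants `C` and `β₀ > 0` such that
`|B_pp(β) - (log β)² + 2 K log β - K'| ≤ C e^{-β}` for all `β ≥ β₀`. -/
theorem stmt_19 :
    ∃ C β₀ : ℝ, 0 < β₀ ∧ ∀ β : ℝ, β₀ ≤ β →
      |Bpp β - (Real.log β) ^ 2 +
          2 * (∫ v in Set.Ioi (0 : ℝ), Real.log (2 * v) / (Real.cosh v) ^ 2) *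
            Real.log β -
          ∫ v in Set.Ioi (0 : ℝ), (Real.log (2 * v)) ^ 2 / (Real.cosh v) ^ 2| ≤
        C * Real.exp (-β) := by
  refine ⟨32, 1, one_pos, fun β hβ => ?_⟩
  have hb : 0 < β := by linarith
  obtain ⟨hi, hI⟩ := aux_int_main (Real.log β)
  have ht := aux_tail hβ
  have hs := intervalIntegral.integral_interval_add_Ioi hi
    (hi.mono_set (Set.Ioi_subset_Ioi (show 0 ≤ β / 2 by positivity)))
  rw [← aux_Bpp hb, hI] at hs
  rw [← abs_neg] at ht
  refine le_of_eq_of_le ?_ ht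
  congr 1
  linarith
end
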